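/- arXiv:1801.07898 — 3 statements merged into one kernel-verified Lean document; each statement's English description precedes it below -/
import Mathlib

section
/- Let A be the matrix-model algebra determined by k, r_1, …, r_K and S. Let ℳ_A be the set of block matrices M ∈ M_{(a_1 + ⋯ + a_K) × n}(k), with block rows of heights a_1, …, a_K and block columns of widths r_1, …, r_K, such that the (i, j) block M_{ij} ∈ M_{a_i × r_j}(k) is zero whenever (i, j) ∉ S. Let G_l = GL_{a_1}(k) × ⋯ × GL_{a_K}(k) act on ℳ_A by left multiplication by block-diagonal matrices and let G_r = GL_{r_1}(k) × ⋯ × GL_{r_K}(k) act by right multiplication by block-diagonal matrices. Then the map sending M ∈ ℳ_A to the left ideal of A contained in J(A) corresponding to the K-tuple of row spaces of the block rows M_1, …, M_K of M induces a bijection between the set of double cosets G_l M G_r (M ∈ ℳ_A) and the set of conjugacy classes of left ideals of A contained in J(A). -/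
open scoped Matrix

/-- Row/column index set: pairs `(i, t)` with `1 ≤ i ≤ K`, `1 ≤ t ≤ rᵢ`. -/
abbrev MIdx (K : ℕ) (r : Fin K → ℕ) : Type := Σ i : Fin K, Fin (r i)

/-- The matrix-model algebra determined by `k`, `r₁, …, r_K` and `S`: the `k`-subalgebra of
`M_n(k[x]/(x²))` of matrices whose `((i,t),(j,s))` entry has zero constant term whenever
`i ≠ j` and zero `x`-coefficient whenever `(i, j) ∉ S`. -/
def ModelAlgebra (k : Type) [Field k] (K : ℕ) (r : Fin K → ℕ)
    (S : Set (Fin K × Fin K)) :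
    Subalgebra k (Matrix (MIdx K r) (MIdx K r) (DualNumber k)) where
  carrier := {M | ∀ p q : MIdx K r,
    (p.1 ≠ q.1 → (M p q).fst = 0) ∧ ((p.1, q.1) ∉ S → (M p q).snd = 0)}
  add_mem' := by
    intro M N hM hN p q
    refine ⟨fun h => ?_, fun h => ?_⟩
    · simp [Matrix.add_apply, (hM p q).1 h, (hN p q).1 h]
    · simp [Matrix.add_apply, (hM p q).2 h, (hN p q).2 h]
  mul_mem' := by
    intro M N hM hN p q
    constructor
    · intro h
      rw [Matrix.mul_apply, TrivSqZeroExt.fst_sum]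
      refine Finset.sum_eq_zero fun x _ => ?_
      rw [TrivSqZeroExt.fst_mul]
      by_cases hx : p.1 = x.1
      · rw [(hN x q).1 (hx ▸ h), mul_zero]
      · rw [(hM p x).1 hx, zero_mul]
    · intro h
      rw [Matrix.mul_apply, TrivSqZeroExt.snd_sum]
      refine Finset.sum_eq_zero fun x _ => ?_
      rw [TrivSqZeroExt.snd_mul]
      by_cases hx : p.1 = x.1
      · have h1 : (N x q).snd = 0 := (hN x q).2 (by rw [← hx]; exact h)
        by_cases hx2 : x.1 = q.1
        · have h2 : (M p x).snd = 0 := (hM p x).2 (by rw [hx, hx2] at h ⊢; exact h)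
          simp [h1, h2]
        · have h2 : (N x q).fst = 0 := (hN x q).1 hx2
          simp [h1, h2]
      · have h1 : (M p x).fst = 0 := (hM p x).1 hx
        by_cases hx2 : x.1 = q.1
        · have h2 : (M p x).snd = 0 := (hM p x).2 (by rw [hx2]; exact h)
          simp [h1, h2]
        · have h2 : (N x q).fst = 0 := (hN x q).1 hx2
          simp [h1, h2]
  algebraMap_mem' := by
    intro c p q
    rw [Matrix.algebraMap_matrix_apply]
    by_cases hpq : p = q
    · subst hpq
      refine ⟨fun h => absurd rfl h, fun _ => ?_⟩
      rw [if_pos rfl]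
      rfl
    · refine ⟨fun h => ?_, fun h => ?_⟩ <;> simp [hpq]

/-- The subspace `𝕍ᵢ = { v ∈ kⁿ : v_{(j,s)} = 0 whenever (i,j) ∉ S }`. -/
def Vspace (k : Type) [Field k] (K : ℕ) (r : Fin K → ℕ) (S : Set (Fin K × Fin K))
    (i : Fin K) : Submodule k (MIdx K r → k) where
  carrier := {v | ∀ q : MIdx K r, (i, q.1) ∉ S → v q = 0}
  add_mem' := by intro a b ha hb q hq; simp [ha q hq, hb q hq]
  zero_mem' := by intro q hq; rfl
  smul_mem' := by intro c a ha q hq; simp [ha q hq]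

/-- The set of elements of `J(A)` all of whose rows have their vector of `x`-coefficients in
the corresponding subspace of the tuple `V`. -/
def TupleSet (k : Type) [Field k] (K : ℕ) (r : Fin K → ℕ) (S : Set (Fin K × Fin K))
    (V : Fin K → Submodule k (MIdx K r → k)) : Set ↥(ModelAlgebra k K r S) :=
  {m | m ∈ (⊥ : Ideal ↥(ModelAlgebra k K r S)).jacobson ∧
    ∀ p : MIdx K r,
      (fun q => ((m : Matrix (MIdx K r) (MIdx K r) (DualNumber k)) p q).snd) ∈ V p.1}

/-- `aᵢ = Σ_{j : (i,j) ∈ S} r_j`. -/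
def aDim (K : ℕ) (r : Fin K → ℕ) (S : Set (Fin K × Fin K)) [DecidablePred (· ∈ S)]
    (i : Fin K) : ℕ :=
  ∑ j ∈ Finset.univ.filter (fun j => (i, j) ∈ S), r j

/-- Row index set of the block matrices in `ℳ_A`: pairs `(i, t)` with `1 ≤ t ≤ aᵢ`. -/
abbrev BIdx (K : ℕ) (r : Fin K → ℕ) (S : Set (Fin K × Fin K))
    [DecidablePred (· ∈ S)] : Type :=
  Σ i : Fin K, Fin (aDim K r S i)

/-- The set `ℳ_A` of block matrices whose `(i,j)` block vanishes whenever `(i,j) ∉ S`. -/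
def MSet (k : Type) [Field k] (K : ℕ) (r : Fin K → ℕ) (S : Set (Fin K × Fin K))
    [DecidablePred (· ∈ S)] : Set (Matrix (BIdx K r S) (MIdx K r) k) :=
  {M | ∀ p q, (p.1, q.1) ∉ S → M p q = 0}

/-- Block-diagonal matrix of an element of `G_l = GL_{a₁}(k) × ⋯ × GL_{a_K}(k)`. -/
def Dl (k : Type) [Field k] (K : ℕ) (r : Fin K → ℕ) (S : Set (Fin K × Fin K))
    [DecidablePred (· ∈ S)]
    (g : ∀ i : Fin K, Matrix.GeneralLinearGroup (Fin (aDim K r S i)) k) :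
    Matrix (BIdx K r S) (BIdx K r S) k :=
  Matrix.blockDiagonal' (fun i => (g i : Matrix (Fin (aDim K r S i)) (Fin (aDim K r S i)) k))

/-- Block-diagonal matrix of an element of `G_r = GL_{r₁}(k) × ⋯ × GL_{r_K}(k)`. -/
def Dr (k : Type) [Field k] (K : ℕ) (r : Fin K → ℕ)
    (h : ∀ j : Fin K, Matrix.GeneralLinearGroup (Fin (r j)) k) :
    Matrix (MIdx K r) (MIdx K r) k :=
  Matrix.blockDiagonal' (fun j => (h j : Matrix (Fin (r j)) (Fin (r j)) k))

/-- The tuple of row spaces of the block rows `M₁, …, M_K` of `M ∈ ℳ_A`. -/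
def rowTuple (k : Type) [Field k] (K : ℕ) (r : Fin K → ℕ) (S : Set (Fin K × Fin K))
    [DecidablePred (· ∈ S)] (M : Matrix (BIdx K r S) (MIdx K r) k)
    (i : Fin K) : Submodule k (MIdx K r → k) :=
  Submodule.span k (Set.range fun t : Fin (aDim K r S i) => M ⟨i, t⟩)

namespace ModelAlgebra

variable {k : Type} [Field k] {K : ℕ} {r : Fin K → ℕ} {S : Set (Fin K × Fin K)}

/-- The matrix of constant terms, as a ring homomorphism. -/
def constHom (k : Type) [Field k] (K : ℕ) (r : Fin K → ℕ) (S : Set (Fin K × Fin K)) :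
    ↥(ModelAlgebra k K r S) →+* Matrix (MIdx K r) (MIdx K r) k :=
  (RingHom.mapMatrix (TrivSqZeroExt.fstHom k k k).toRingHom).comp
    (ModelAlgebra k K r S).val.toRingHom

/-- The matrix of `x`-coefficients. -/
def coeffX (m : ↥(ModelAlgebra k K r S)) : Matrix (MIdx K r) (MIdx K r) k :=
  fun p q => (m.1 p q).snd

theorem constHom_apply (m : ↥(ModelAlgebra k K r S)) (p q : MIdx K r) :
    constHom k K r S m p q = (m.1 p q).fst := rfl

theorem coeffX_apply (m : ↥(ModelAlgebra k K r S)) (p q : MIdx K r) :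
    coeffX m p q = (m.1 p q).snd := rfl

theorem ext_parts {m m' : ↥(ModelAlgebra k K r S)}
    (h₁ : constHom k K r S m = constHom k K r S m') (h₂ : coeffX m = coeffX m') : m = m' := by
  apply Subtype.ext
  ext p q
  · exact congrFun (congrFun h₁ p) q
  · exact congrFun (congrFun h₂ p) q

theorem constHom_eq_zero (m : ↥(ModelAlgebra k K r S)) {p q : MIdx K r} (h : p.1 ≠ q.1) :
    constHom k K r S m p q = 0 :=
  (m.2 p q).1 h

theorem coeffX_eq_zero (m : ↥(ModelAlgebra k K r S)) {p q : MIdx K r} (h : (p.1, q.1) ∉ S) :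
    coeffX m p q = 0 :=
  (m.2 p q).2 h

theorem coeffX_mul (m m' : ↥(ModelAlgebra k K r S)) :
    coeffX (m * m') = constHom k K r S m * coeffX m' + coeffX m * constHom k K r S m' := by
  ext p q
  simp only [coeffX_apply, constHom_apply, Matrix.add_apply, Matrix.mul_apply,
    MulMemClass.coe_mul, TrivSqZeroExt.snd_sum, TrivSqZeroExt.snd_mul, Finset.sum_add_distrib,
    smul_eq_mul, MulOpposite.smul_eq_mul_unop, MulOpposite.unop_op]

theorem coeffX_add (m m' : ↥(ModelAlgebra k K r S)) :
    coeffX (m + m') = coeffX m + coeffX m' := rfl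

theorem coeffX_sum {ι : Type} (s : Finset ι) (f : ι → ↥(ModelAlgebra k K r S)) :
    coeffX (∑ i ∈ s, f i) = ∑ i ∈ s, coeffX (f i) :=
  map_sum (⟨⟨coeffX, rfl⟩, coeffX_add⟩ :
    ↥(ModelAlgebra k K r S) →+ Matrix (MIdx K r) (MIdx K r) k) f s

/-- The element with given constant terms and `x`-coefficients. -/
def ofParts (f s : Matrix (MIdx K r) (MIdx K r) k) (hf : ∀ p q, p.1 ≠ q.1 → f p q = 0)
    (hs : ∀ p q, (p.1, q.1) ∉ S → s p q = 0) : ↥(ModelAlgebra k K r S) :=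
  ⟨fun p q => (f p q, s p q), fun p q => ⟨hf p q, hs p q⟩⟩

/-- The element with given block-diagonal constant terms and vanishing `x`-coefficients. -/
def ofConst (f : Matrix (MIdx K r) (MIdx K r) k) (hf : ∀ p q, p.1 ≠ q.1 → f p q = 0) :
    ↥(ModelAlgebra k K r S) :=
  ofParts f 0 hf fun _ _ _ => rfl

theorem constHom_ofConst (f : Matrix (MIdx K r) (MIdx K r) k) (hf) :
    constHom k K r S (ofConst f hf) = f := rfl

theorem coeffX_ofConst (f : Matrix (MIdx K r) (MIdx K r) k) (hf) :
    coeffX (ofConst (S := S) f hf) = 0 := rfl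

theorem single_eq_zero_of_fst_ne {p q : MIdx K r} (h : p.1 = q.1) (c : k) (a b : MIdx K r)
    (hab : a.1 ≠ b.1) : Matrix.single p q c a b = 0 := by
  rw [Matrix.single_apply, if_neg]
  rintro ⟨rfl, rfl⟩
  exact hab h

theorem mem_jacobson_iff_constHom (m : ↥(ModelAlgebra k K r S)) :
    m ∈ (⊥ : Ideal ↥(ModelAlgebra k K r S)).jacobson ↔ constHom k K r S m = 0 := by
  rw [Ideal.mem_jacobson_iff]
  constructor
  · intro h
    ext p q
    by_contra hne
    have hpq : p.1 = q.1 := by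
      by_contra hpq
      exact hne (constHom_eq_zero m hpq)
    obtain ⟨z, hz⟩ := h (ofConst (Matrix.single q p (-(constHom k K r S m p q)⁻¹))
      (single_eq_zero_of_fst_ne hpq.symm _))
    rw [Ideal.mem_bot, sub_eq_zero] at hz
    have hz' := congrArg (constHom k K r S) hz
    rw [map_add, map_mul, map_mul, map_one, constHom_ofConst] at hz'
    have hqq := congrFun (congrFun hz' q) q
    rw [Matrix.add_apply, Matrix.mul_assoc, Matrix.mul_apply,
      Finset.sum_eq_single q, Matrix.single_mul_apply_same, neg_mul,
      inv_mul_cancel₀ hne, Matrix.one_apply_eq] at hqq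
    · simp at hqq
    · intro b _ hb
      rw [Matrix.single_mul_apply_of_ne _ _ _ _ _ hb, mul_zero]
    · simp
  · intro h y
    refine ⟨1 - y * m, ?_⟩
    have hsq : (y * m) * (y * m) = 0 := by
      apply ext_parts
      · simp [h]
      · rw [coeffX_mul]
        simp [h]
        rfl
    rw [Ideal.mem_bot]
    have : (1 - y * m) * y * m + (1 - y * m) - 1 = - ((y * m) * (y * m)) := by
      rw [mul_assoc (1 - y * m), sub_mul, one_mul]
      abel
    rw [this, hsq, neg_zero]

theorem mem_tupleSet_iff (V : Fin K → Submodule k (MIdx K r → k))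
    (m : ↥(ModelAlgebra k K r S)) :
    m ∈ TupleSet k K r S V ↔ constHom k K r S m = 0 ∧ ∀ p, coeffX m p ∈ V p.1 := by
  rw [← mem_jacobson_iff_constHom]
  rfl

theorem constHom_mul_row_mem (V : Fin K → Submodule k (MIdx K r → k))
    (a : ↥(ModelAlgebra k K r S)) (X : Matrix (MIdx K r) (MIdx K r) k)
    (hX : ∀ p, X p ∈ V p.1) (p : MIdx K r) : (constHom k K r S a * X) p ∈ V p.1 := by
  have : (constHom k K r S a * X) p = ∑ x, constHom k K r S a p x • X x := by
    ext q
    simp [Matrix.mul_apply, Finset.sum_apply]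
  rw [this]
  refine Submodule.sum_mem _ fun x _ => ?_
  by_cases hx : p.1 = x.1
  · exact Submodule.smul_mem _ _ (hx ▸ hX x)
  · rw [constHom_eq_zero a hx, zero_smul]
    exact Submodule.zero_mem _

/-- The left ideal corresponding to a tuple of subspaces. -/
def tupleIdeal (S : Set (Fin K × Fin K)) (V : Fin K → Submodule k (MIdx K r → k)) :
    Ideal ↥(ModelAlgebra k K r S) where
  carrier := TupleSet k K r S V
  add_mem' := by
    intro a b ha hb
    rw [mem_tupleSet_iff] at *
    exact ⟨by rw [map_add, ha.1, hb.1, add_zero],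
      fun p => Submodule.add_mem _ (ha.2 p) (hb.2 p)⟩
  zero_mem' := by
    rw [mem_tupleSet_iff]
    exact ⟨map_zero _, fun p => Submodule.zero_mem _⟩
  smul_mem' := by
    intro c m hm
    rw [mem_tupleSet_iff] at *
    rw [smul_eq_mul, map_mul, coeffX_mul, hm.1, mul_zero, mul_zero, add_zero]
    exact ⟨rfl, constHom_mul_row_mem V c _ hm.2⟩

theorem tupleIdeal_le_jacobson (V : Fin K → Submodule k (MIdx K r → k)) :
    tupleIdeal S V ≤ (⊥ : Ideal ↥(ModelAlgebra k K r S)).jacobson :=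
  fun _ h => h.1

/-- The element of the radical whose only nonzero row is the `p`-th one, with vector of
`x`-coefficients `v`. -/
def rowElt (p : MIdx K r) (v : MIdx K r → k) (hv : v ∈ Vspace k K r S p.1) :
    ↥(ModelAlgebra k K r S) :=
  ofParts 0 (fun a => Pi.single (M := fun _ => MIdx K r → k) p v a) (fun _ _ _ => rfl) (by
    intro a b hab
    by_cases h : a = p
    · subst h
      simpa using hv b hab
    · simp [Pi.single_eq_of_ne h])

theorem constHom_rowElt (p : MIdx K r) (v : MIdx K r → k) (hv) :
    constHom k K r S (rowElt p v hv) = 0 := rfl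

theorem coeffX_rowElt (p : MIdx K r) (v : MIdx K r → k) (hv) :
    coeffX (rowElt (S := S) p v hv) = Pi.single (M := fun _ => MIdx K r → k) p v := rfl

theorem coeffX_mem_vspace (m : ↥(ModelAlgebra k K r S)) (p : MIdx K r) :
    coeffX m p ∈ Vspace k K r S p.1 :=
  fun _ hq => coeffX_eq_zero m hq

theorem rowElt_mem_tupleSet_iff (V : Fin K → Submodule k (MIdx K r → k)) (p : MIdx K r)
    (v : MIdx K r → k) (hv) :
    rowElt p v hv ∈ TupleSet k K r S V ↔ v ∈ V p.1 := by
  rw [mem_tupleSet_iff, constHom_rowElt, coeffX_rowElt]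
  constructor
  · intro h
    simpa using h.2 p
  · intro h
    refine ⟨rfl, fun a => ?_⟩
    by_cases ha : a = p
    · subst ha
      simpa using h
    · rw [Pi.single_eq_of_ne ha]
      exact Submodule.zero_mem _

theorem le_of_tupleSet_subset (hr : ∀ i, 0 < r i) {V W : Fin K → Submodule k (MIdx K r → k)}
    (hV : ∀ i, V i ≤ Vspace k K r S i) (h : TupleSet k K r S V ⊆ TupleSet k K r S W) (i : Fin K) :
    V i ≤ W i := by
  intro v hv
  have := h ((rowElt_mem_tupleSet_iff V ⟨i, ⟨0, hr i⟩⟩ v (hV i hv)).2 hv)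
  rwa [rowElt_mem_tupleSet_iff] at this

theorem tupleSet_injective (hr : ∀ i, 0 < r i) {V W : Fin K → Submodule k (MIdx K r → k)}
    (hV : ∀ i, V i ≤ Vspace k K r S i) (hW : ∀ i, W i ≤ Vspace k K r S i)
    (h : TupleSet k K r S V = TupleSet k K r S W) : V = W :=
  funext fun i => le_antisymm (le_of_tupleSet_subset hr hV h.subset i)
    (le_of_tupleSet_subset hr hW h.superset i)

/-- The subspace spanned by the rows of `x`-coefficients, in the `i`-th block of rows, of the
elements of a left ideal. -/
def rowSpaces (L : Ideal ↥(ModelAlgebra k K r S)) (i : Fin K) : Submodule k (MIdx K r → k) :=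
  Submodule.span k {v | ∃ m ∈ L, ∃ t, coeffX m ⟨i, t⟩ = v}

theorem rowSpaces_le (L : Ideal ↥(ModelAlgebra k K r S)) (i : Fin K) :
    rowSpaces L i ≤ Vspace k K r S i := by
  refine Submodule.span_le.2 ?_
  rintro _ ⟨m, -, t, rfl⟩
  exact coeffX_mem_vspace m ⟨i, t⟩

theorem rowElt_mem_of_mem_rowSpaces {L : Ideal ↥(ModelAlgebra k K r S)}
    (hL : L ≤ (⊥ : Ideal ↥(ModelAlgebra k K r S)).jacobson) (p : MIdx K r) (v : MIdx K r → k)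
    (hv : v ∈ rowSpaces L p.1) : rowElt p v (rowSpaces_le L p.1 hv) ∈ L := by
  suffices h : ∃ m ∈ L, coeffX m = Pi.single (M := fun _ => MIdx K r → k) p v by
    obtain ⟨m, hm, hmv⟩ := h
    have : rowElt p v (rowSpaces_le L p.1 hv) = m :=
      ext_parts ((mem_jacobson_iff_constHom m).1 (hL hm)).symm hmv.symm
    exact this ▸ hm
  induction hv using Submodule.span_induction with
  | mem v hv =>
    obtain ⟨m, hm, t, rfl⟩ := hv
    refine ⟨ofConst (Matrix.single p ⟨p.1, t⟩ 1)
      (single_eq_zero_of_fst_ne (p := p) (q := ⟨p.1, t⟩) rfl _) * m,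
      L.mul_mem_left _ hm, ?_⟩
    rw [coeffX_mul, constHom_ofConst, coeffX_ofConst, zero_mul, add_zero]
    ext a b
    by_cases ha : a = p
    · subst ha
      rw [Matrix.single_mul_apply_same, one_mul, Pi.single_eq_same]
    · rw [Matrix.single_mul_apply_of_ne _ _ _ _ _ ha, Pi.single_eq_of_ne ha]
      rfl
  | zero => exact ⟨0, L.zero_mem, by rw [Pi.single_zero]; rfl⟩
  | add v w _ _ hv hw =>
    obtain ⟨m, hm, hmv⟩ := hv
    obtain ⟨m', hm', hmw⟩ := hw
    exact ⟨m + m', L.add_mem hm hm', by rw [coeffX_add, hmv, hmw, Pi.single_add]; rfl⟩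
  | smul c v _ hv =>
    obtain ⟨m, hm, hmv⟩ := hv
    refine ⟨algebraMap k _ c * m, L.mul_mem_left _ hm, ?_⟩
    rw [← Algebra.smul_def, Pi.single_smul, ← hmv]
    rfl

theorem eq_sum_rowElt (m : ↥(ModelAlgebra k K r S)) (hm : constHom k K r S m = 0) :
    m = ∑ p, rowElt p (coeffX m p) (coeffX_mem_vspace m p) := by
  apply ext_parts
  · rw [map_sum, hm]
    exact (Finset.sum_eq_zero fun _ _ => constHom_rowElt _ _ _).symm
  · rw [coeffX_sum]
    simp only [coeffX_rowElt]
    exact (Finset.univ_sum_single (M := fun _ => MIdx K r → k) (coeffX m)).symm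

theorem coe_eq_tupleSet_rowSpaces {L : Ideal ↥(ModelAlgebra k K r S)}
    (hL : L ≤ (⊥ : Ideal ↥(ModelAlgebra k K r S)).jacobson) :
    (L : Set ↥(ModelAlgebra k K r S)) = TupleSet k K r S (rowSpaces L) := by
  ext m
  rw [mem_tupleSet_iff]
  constructor
  · intro hm
    exact ⟨(mem_jacobson_iff_constHom m).1 (hL hm),
      fun p => Submodule.subset_span ⟨m, hm, p.2, rfl⟩⟩
  · rintro ⟨hm, hrow⟩
    rw [eq_sum_rowElt m hm]
    exact L.sum_mem fun p _ => rowElt_mem_of_mem_rowSpaces hL p _ (hrow p)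

theorem finrank_vspace_le [DecidablePred (· ∈ S)] (i : Fin K) :
    Module.finrank k (Vspace k K r S i) ≤ aDim K r S i := by
  classical
  let φ : Vspace k K r S i →ₗ[k] ((Σ j : {j : Fin K // (i, j) ∈ S}, Fin (r j)) → k) :=
    { toFun := fun v q => v.1 ⟨q.1, q.2⟩
      map_add' := fun _ _ => rfl
      map_smul' := fun _ _ => rfl }
  have hφ : Function.Injective φ := by
    intro v w h
    ext q
    by_cases hq : (i, q.1) ∈ S
    · exact congrFun h ⟨⟨q.1, hq⟩, q.2⟩
    · rw [v.2 q hq, w.2 q hq]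
  refine (LinearMap.finrank_le_finrank_of_injective hφ).trans ?_
  rw [Module.finrank_fintype_fun_eq_card, Fintype.card_sigma, aDim]
  simp only [Fintype.card_fin]
  rw [Finset.sum_subtype (p := fun j => (i, j) ∈ S) _ (by simp)]

theorem rowTuple_le_vspace [DecidablePred (· ∈ S)] {M : Matrix (BIdx K r S) (MIdx K r) k}
    (hM : M ∈ MSet k K r S) (i : Fin K) : rowTuple k K r S M i ≤ Vspace k K r S i := by
  refine Submodule.span_le.2 ?_
  rintro _ ⟨t, rfl⟩ q hq
  exact hM ⟨i, t⟩ q hq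

end ModelAlgebra

theorem Submodule.exists_span_range_eq_of_finrank_le {k E : Type*} [Field k] [AddCommGroup E]
    [Module k E] [FiniteDimensional k E] (W : Submodule k E) {a : ℕ}
    (h : Module.finrank k W ≤ a) : ∃ f : Fin a → E, span k (Set.range f) = W := by
  let b := Module.finBasis k W
  refine ⟨fun t => if ht : t.1 < Module.finrank k W then b ⟨t, ht⟩ else 0,
    le_antisymm (span_le.2 ?_) ?_⟩
  · rintro _ ⟨t, rfl⟩
    dsimp only
    split_ifs
    · exact (b _).2
    · exact W.zero_mem
  · have hW : W = span k (Set.range fun j => (b j : E)) := by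
      have := congrArg (Submodule.map W.subtype) b.span_eq
      rw [map_span, map_top, range_subtype, ← Set.range_comp] at this
      exact this.symm
    conv_lhs => rw [hW]
    refine span_mono ?_
    rintro _ ⟨j, rfl⟩
    exact ⟨⟨j, j.2.trans_le h⟩, by simp⟩

theorem LinearMap.exists_linearEquiv_comp_eq_of_range_eq {k F E : Type*} [Field k]
    [AddCommGroup F] [Module k F] [FiniteDimensional k F] [AddCommGroup E] [Module k E]
    (φ ψ : F →ₗ[k] E) (h : range φ = range ψ) : ∃ e : F ≃ₗ[k] F, φ ∘ₗ e.toLinearMap = ψ := by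
  obtain ⟨C, hC⟩ := (ker φ).exists_isCompl
  obtain ⟨D, hD⟩ := (ker ψ).exists_isCompl
  have hker : Module.finrank k (ker ψ) = Module.finrank k (ker φ) := by
    have h₁ := φ.finrank_range_add_finrank_ker
    have h₂ := ψ.finrank_range_add_finrank_ker
    rw [h] at h₁
    omega
  let eK : ker ψ ≃ₗ[k] ker φ := LinearEquiv.ofFinrankEq _ _ hker
  let eC : C ≃ₗ[k] range φ :=
    (Submodule.quotientEquivOfIsCompl _ _ hC).symm.trans φ.quotKerEquivRange
  let eD : D ≃ₗ[k] range ψ :=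
    (Submodule.quotientEquivOfIsCompl _ _ hD).symm.trans ψ.quotKerEquivRange
  have hCapp : ∀ c : C, (eC c : E) = φ c := fun c => by simp [eC]
  have hDapp : ∀ d : D, (eD d : E) = ψ d := fun d => by simp [eD]
  let eDC : D ≃ₗ[k] C := (eD.trans (LinearEquiv.ofEq _ _ h.symm)).trans eC.symm
  have hDC : ∀ d : D, φ (eDC d) = ψ d := fun d => by
    rw [← hCapp, ← hDapp]
    simp [eDC]
  refine ⟨(Submodule.prodEquivOfIsCompl _ _ hD).symm.trans
    ((eK.prodCongr eDC).trans (Submodule.prodEquivOfIsCompl _ _ hC)), ?_⟩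
  ext x
  obtain ⟨⟨y, d⟩, rfl⟩ := (Submodule.prodEquivOfIsCompl _ _ hD).surjective x
  have hy : φ (eK y) = 0 := (eK y).2
  have hy' : ψ y = 0 := y.2
  simp [hDC, hy, hy']

theorem Matrix.exists_generalLinearGroup_of_span_eq {k E : Type*} [Field k] [AddCommGroup E]
    [Module k E] {a : ℕ} (f f' : Fin a → E)
    (h : Submodule.span k (Set.range f) = Submodule.span k (Set.range f')) :
    ∃ g : Matrix.GeneralLinearGroup (Fin a) k, ∀ t, f' t = ∑ s, g.1 t s • f s := by
  obtain ⟨e, he⟩ := LinearMap.exists_linearEquiv_comp_eq_of_range_eq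
    (Fintype.linearCombination k f) (Fintype.linearCombination k f')
    (by rw [Fintype.range_linearCombination, Fintype.range_linearCombination, h])
  let P : Matrix (Fin a) (Fin a) k := LinearMap.toMatrix' e.toLinearMap
  let Q : Matrix (Fin a) (Fin a) k := LinearMap.toMatrix' e.symm.toLinearMap
  have hPQ : P * Q = 1 := by
    rw [← LinearMap.toMatrix'_comp]
    simp
  have hQP : Q * P = 1 := by
    rw [← LinearMap.toMatrix'_comp]
    simp
  refine ⟨⟨Pᵀ, Qᵀ, by rw [← Matrix.transpose_mul, hQP, Matrix.transpose_one],
    by rw [← Matrix.transpose_mul, hPQ, Matrix.transpose_one]⟩, fun t => ?_⟩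
  have := LinearMap.congr_fun he (Pi.single t 1)
  rw [Fintype.linearCombination_apply_single, one_smul] at this
  rw [← this]
  simp [Fintype.linearCombination_apply, P, LinearMap.toMatrix'_apply]

namespace ModelAlgebra

variable {k : Type} [Field k] {K : ℕ} {r : Fin K → ℕ} {S : Set (Fin K × Fin K)}

theorem conj_mem_tupleSet {V : Fin K → Submodule k (MIdx K r → k)}
    (u : (↥(ModelAlgebra k K r S))ˣ) {m : ↥(ModelAlgebra k K r S)}
    (hm : m ∈ TupleSet k K r S V) :
    (u : ↥(ModelAlgebra k K r S)) * m * ((u⁻¹ : _ˣ) : ↥(ModelAlgebra k K r S)) ∈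
      TupleSet k K r S fun i => (V i).map
        (constHom k K r S ((u⁻¹ : _ˣ) : ↥(ModelAlgebra k K r S))).vecMulLinear := by
  rw [mem_tupleSet_iff] at *
  rw [coeffX_mul, coeffX_mul, map_mul, map_mul, hm.1, mul_zero, mul_zero, zero_mul, zero_mul,
    zero_add, add_zero]
  exact ⟨rfl, fun p => ⟨_, constHom_mul_row_mem V _ _ hm.2 p, rfl⟩⟩

theorem conj_image_tupleSet (V : Fin K → Submodule k (MIdx K r → k))
    (u : (↥(ModelAlgebra k K r S))ˣ) :
    (fun x => (u : ↥(ModelAlgebra k K r S)) * x * ((u⁻¹ : _ˣ) : ↥(ModelAlgebra k K r S))) ''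
        TupleSet k K r S V =
      TupleSet k K r S fun i => (V i).map
        (constHom k K r S ((u⁻¹ : _ˣ) : ↥(ModelAlgebra k K r S))).vecMulLinear := by
  apply Set.Subset.antisymm
  · rintro _ ⟨m, hm, rfl⟩
    exact conj_mem_tupleSet u hm
  · intro m hm
    refine ⟨((u⁻¹ : _ˣ) : ↥(ModelAlgebra k K r S)) * m * (u : ↥(ModelAlgebra k K r S)), ?_, ?_⟩
    · have := conj_mem_tupleSet u⁻¹ hm
      rw [inv_inv] at this
      convert this using 2
      ext1 i
      rw [← Submodule.map_comp]
      have hid : (constHom k K r S (u : ↥(ModelAlgebra k K r S))).vecMulLinear ∘ₗ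
          (constHom k K r S ((u⁻¹ : _ˣ) : ↥(ModelAlgebra k K r S))).vecMulLinear =
            LinearMap.id := by
        refine LinearMap.ext fun v => ?_
        rw [LinearMap.comp_apply, Matrix.vecMulLinear_apply, Matrix.vecMulLinear_apply,
          Matrix.vecMul_vecMul, ← map_mul, u.inv_mul, map_one, Matrix.vecMul_one,
          LinearMap.id_apply]
      rw [hid, Submodule.map_id]
    · simp [mul_assoc]

theorem map_le_vspace {V : Submodule k (MIdx K r → k)} {i : Fin K} (hV : V ≤ Vspace k K r S i)
    (a : ↥(ModelAlgebra k K r S)) :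
    V.map (constHom k K r S a).vecMulLinear ≤ Vspace k K r S i := by
  rintro _ ⟨v, hv, rfl⟩ q hq
  rw [Matrix.vecMulLinear_apply, Matrix.vecMul, dotProduct]
  refine Finset.sum_eq_zero fun x _ => ?_
  by_cases hx : x.1 = q.1
  · rw [hV hv x (hx ▸ hq), zero_mul]
  · rw [constHom_eq_zero a hx, mul_zero]

theorem Dr_eq_zero (h : ∀ j : Fin K, Matrix.GeneralLinearGroup (Fin (r j)) k) (p q : MIdx K r)
    (hpq : p.1 ≠ q.1) : Dr k K r h p q = 0 :=
  Matrix.blockDiagonal'_apply_ne _ _ _ hpq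

theorem Dr_mul_Dr_inv (h : ∀ j : Fin K, Matrix.GeneralLinearGroup (Fin (r j)) k) :
    Dr k K r h * Dr k K r h⁻¹ = 1 := by
  rw [Dr, Dr, ← Matrix.blockDiagonal'_mul, ← Matrix.blockDiagonal'_one]
  congr 1
  ext1 j
  exact (h j).mul_inv

/-- The unit of the matrix-model algebra given by a constant block-diagonal matrix. -/
def unitOfGL (S : Set (Fin K × Fin K))
    (h : ∀ j : Fin K, Matrix.GeneralLinearGroup (Fin (r j)) k) :
    (↥(ModelAlgebra k K r S))ˣ where
  val := ofConst (Dr k K r h) (Dr_eq_zero h)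
  inv := ofConst (Dr k K r h⁻¹) (Dr_eq_zero h⁻¹)
  val_inv := by
    apply ext_parts
    · rw [map_mul, map_one, constHom_ofConst, constHom_ofConst, Dr_mul_Dr_inv]
    · rw [coeffX_mul, coeffX_ofConst, coeffX_ofConst, mul_zero, zero_mul, add_zero]
      ext p q
      by_cases hpq : p = q <;> simp [coeffX_apply, hpq]
  inv_val := by
    apply ext_parts
    · have := Dr_mul_Dr_inv h⁻¹
      rw [inv_inv] at this
      rw [map_mul, map_one, constHom_ofConst, constHom_ofConst, this]
    · rw [coeffX_mul, coeffX_ofConst, coeffX_ofConst, mul_zero, zero_mul, add_zero]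
      ext p q
      by_cases hpq : p = q <;> simp [coeffX_apply, hpq]

theorem constHom_eq_blockDiagonal' (a : ↥(ModelAlgebra k K r S)) :
    constHom k K r S a =
      Matrix.blockDiagonal' fun j => (constHom k K r S a).blockDiag' j := by
  ext ⟨i, s⟩ ⟨j, t⟩
  by_cases hij : i = j
  · subst hij
    rw [Matrix.blockDiagonal'_apply_eq]
    rfl
  · rw [Matrix.blockDiagonal'_apply_ne _ _ _ hij]
    exact constHom_eq_zero a hij

theorem blockDiag'_mul_blockDiag'_eq_one {a b : ↥(ModelAlgebra k K r S)} (hab : a * b = 1)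
    (j : Fin K) :
    (constHom k K r S a).blockDiag' j * (constHom k K r S b).blockDiag' j = 1 := by
  have h := congrArg (constHom k K r S) hab
  rw [map_mul, map_one, constHom_eq_blockDiagonal' a, constHom_eq_blockDiagonal' b,
    ← Matrix.blockDiagonal'_mul, ← Matrix.blockDiagonal'_one] at h
  exact congrFun (Matrix.blockDiagonal'_injective h) j

theorem exists_constHom_eq_Dr (u : (↥(ModelAlgebra k K r S))ˣ) :
    ∃ h, constHom k K r S (u : ↥(ModelAlgebra k K r S)) = Dr k K r h :=
  ⟨fun j => ⟨_, _, blockDiag'_mul_blockDiag'_eq_one u.mul_inv j,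
    blockDiag'_mul_blockDiag'_eq_one u.inv_mul j⟩, constHom_eq_blockDiagonal' _⟩

variable [DecidablePred (· ∈ S)]

theorem rowTuple_mul (M : Matrix (BIdx K r S) (MIdx K r) k)
    (H : Matrix (MIdx K r) (MIdx K r) k) (i : Fin K) :
    rowTuple k K r S (M * H) i = (rowTuple k K r S M i).map H.vecMulLinear := by
  rw [rowTuple, rowTuple, Submodule.map_span, ← Set.range_comp]
  rfl

theorem Dl_mul_row (g : ∀ i : Fin K, Matrix.GeneralLinearGroup (Fin (aDim K r S i)) k)
    (M : Matrix (BIdx K r S) (MIdx K r) k) (i : Fin K) (t : Fin (aDim K r S i)) :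
    (Dl k K r S g * M) ⟨i, t⟩ = ∑ s, (g i).1 t s • M ⟨i, s⟩ := by
  ext q
  rw [Matrix.mul_apply, Fintype.sum_sigma, Finset.sum_eq_single i]
  · simp [Dl, Finset.sum_apply]
  · intro j _ hj
    refine Finset.sum_eq_zero fun s _ => ?_
    rw [Dl, Matrix.blockDiagonal'_apply_ne _ _ _ hj.symm, zero_mul]
  · simp

theorem rowTuple_Dl_mul_le (g : ∀ i : Fin K, Matrix.GeneralLinearGroup (Fin (aDim K r S i)) k)
    (M : Matrix (BIdx K r S) (MIdx K r) k) (i : Fin K) :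
    rowTuple k K r S (Dl k K r S g * M) i ≤ rowTuple k K r S M i := by
  refine Submodule.span_le.2 ?_
  rintro _ ⟨t, rfl⟩
  dsimp only
  rw [Dl_mul_row]
  exact Submodule.sum_mem _ fun s _ => Submodule.smul_mem _ _ (Submodule.subset_span ⟨s, rfl⟩)

theorem rowTuple_Dl_mul (g : ∀ i : Fin K, Matrix.GeneralLinearGroup (Fin (aDim K r S i)) k)
    (M : Matrix (BIdx K r S) (MIdx K r) k) :
    rowTuple k K r S (Dl k K r S g * M) = rowTuple k K r S M := by
  ext1 i
  refine le_antisymm (rowTuple_Dl_mul_le g M i) ?_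
  have hg : Dl k K r S g⁻¹ * (Dl k K r S g * M) = M := by
    have : Dl k K r S g⁻¹ * Dl k K r S g = 1 := by
      rw [Dl, Dl, ← Matrix.blockDiagonal'_mul, ← Matrix.blockDiagonal'_one]
      congr 1
      ext1 j
      exact (g j).inv_mul
    rw [← Matrix.mul_assoc, this, Matrix.one_mul]
  conv_lhs => rw [← hg]
  exact rowTuple_Dl_mul_le g⁻¹ _ i

theorem exists_Dl_mul_eq_iff (M M' : Matrix (BIdx K r S) (MIdx K r) k) :
    (∃ g, M' = Dl k K r S g * M) ↔ rowTuple k K r S M' = rowTuple k K r S M := by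
  constructor
  · rintro ⟨g, rfl⟩
    exact rowTuple_Dl_mul g M
  · intro h
    choose g hg using fun i => Matrix.exists_generalLinearGroup_of_span_eq
      (fun t => M ⟨i, t⟩) (fun t => M' ⟨i, t⟩) (congrFun h i).symm
    refine ⟨g, ?_⟩
    funext p
    rw [Dl_mul_row]
    exact hg p.1 p.2

theorem exists_rowTuple_eq (V : Fin K → Submodule k (MIdx K r → k))
    (hV : ∀ i, V i ≤ Vspace k K r S i) : ∃ M ∈ MSet k K r S, rowTuple k K r S M = V := by
  choose f hf using fun i => (V i).exists_span_range_eq_of_finrank_le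
    ((Submodule.finrank_mono (hV i)).trans (finrank_vspace_le i))
  refine ⟨fun p => f p.1 p.2, fun p q hpq => ?_, funext hf⟩
  have : f p.1 p.2 ∈ V p.1 := hf p.1 ▸ Submodule.subset_span ⟨p.2, rfl⟩
  exact hV p.1 this q hpq

end ModelAlgebra

set_option maxHeartbeats 1000000 in
set_option synthInstance.maxHeartbeats 400000 in
/-- the map sending `M ∈ ℳ_A` to the left ideal of `A` contained in `J(A)`
corresponding to the tuple of row spaces of its block rows induces a bijection between the
double cosets `G_l M G_r` and the conjugacy classes of left ideals of `A` contained in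
`J(A)`. -/
theorem doubleCosets_biject_with_conjClasses
    (k : Type) [Field k] (K : ℕ) (r : Fin K → ℕ) (hr : ∀ i, 0 < r i)
    (S : Set (Fin K × Fin K)) [DecidablePred (· ∈ S)] :
    (∀ M ∈ MSet k K r S, ∃ L : Ideal ↥(ModelAlgebra k K r S),
        L ≤ (⊥ : Ideal ↥(ModelAlgebra k K r S)).jacobson ∧
        (L : Set ↥(ModelAlgebra k K r S)) = TupleSet k K r S (rowTuple k K r S M)) ∧
    (∀ L : Ideal ↥(ModelAlgebra k K r S),
        L ≤ (⊥ : Ideal ↥(ModelAlgebra k K r S)).jacobson →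
        ∃ M ∈ MSet k K r S,
          (L : Set ↥(ModelAlgebra k K r S)) = TupleSet k K r S (rowTuple k K r S M)) ∧
    (∀ M ∈ MSet k K r S, ∀ M' ∈ MSet k K r S,
        ((∃ g h, M' = Dl k K r S g * M * Dr k K r h) ↔
          (∃ u : (↥(ModelAlgebra k K r S))ˣ,
            TupleSet k K r S (rowTuple k K r S M') =
              (fun x => (u : ↥(ModelAlgebra k K r S)) * x * ((u⁻¹ : _ˣ) : ↥(ModelAlgebra k K r S))) ''
                TupleSet k K r S (rowTuple k K r S M)))) := by
  refine ⟨fun M _ => ⟨ModelAlgebra.tupleIdeal S (rowTuple k K r S M),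
    ModelAlgebra.tupleIdeal_le_jacobson _, rfl⟩, fun L hL => ?_, fun M hM M' hM' => ?_⟩
  · obtain ⟨M, hM, hMV⟩ :=
      ModelAlgebra.exists_rowTuple_eq _ (ModelAlgebra.rowSpaces_le L)
    exact ⟨M, hM, by rw [hMV, ModelAlgebra.coe_eq_tupleSet_rowSpaces hL]⟩
  · simp only [ModelAlgebra.conj_image_tupleSet]
    constructor
    · rintro ⟨g, h, rfl⟩
      refine ⟨(ModelAlgebra.unitOfGL S h)⁻¹, ?_⟩
      rw [Matrix.mul_assoc, ModelAlgebra.rowTuple_Dl_mul, inv_inv]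
      exact congrArg _ (funext (ModelAlgebra.rowTuple_mul M _))
    · rintro ⟨u, hu⟩
      have hrow := ModelAlgebra.tupleSet_injective hr (ModelAlgebra.rowTuple_le_vspace hM')
        (fun i => ModelAlgebra.map_le_vspace (ModelAlgebra.rowTuple_le_vspace hM i) _) hu
      obtain ⟨h, hh⟩ := ModelAlgebra.exists_constHom_eq_Dr u⁻¹
      rw [hh] at hrow
      obtain ⟨g, hg⟩ := (ModelAlgebra.exists_Dl_mul_eq_iff (M * Dr k K r h) M').2
        (hrow.trans (funext fun i => (ModelAlgebra.rowTuple_mul M _ i).symm))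
      exact ⟨g, h, by rw [hg, Matrix.mul_assoc]⟩
end

section
/- Let k be an algebraically closed field and let A be the matrix-model algebra determined by k, r_1, …, r_K and S; assume the lattice of two-sided ideals of A is distributive. Let ℳ_A be the set of block matrices M ∈ M_{(a_1 + ⋯ + a_K) × n}(k), with block rows of heights a_1, …, a_K and block columns of widths r_1, …, r_K, such that the (i, j) block M_{ij} ∈ M_{a_i × r_j}(k) is zero whenever (i, j) ∉ S, with the group G_l × G_r (where G_l = GL_{a_1}(k) × ⋯ × GL_{a_K}(k) acts by left multiplication and G_r = GL_{r_1}(k) × ⋯ × GL_{r_K}(k) acts by right multiplication, both by block-diagonal matrices) acting on ℳ_A. Then A has finitely many conjugacy classes of left ideals if and only if the number of G_l × G_r orbits on ℳ_A is finite. -/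
open scoped Matrix

/-- Two elements of `ℳ_A` lie in the same `G_l × G_r` orbit (the same double coset). -/
def DoubleCosetRel (k : Type) [Field k] (K : ℕ) (r : Fin K → ℕ)
    (S : Set (Fin K × Fin K)) [DecidablePred (· ∈ S)]
    (M M' : {M : Matrix (BIdx K r S) (MIdx K r) k // M ∈ MSet k K r S}) : Prop :=
  ∃ g h, (M' : Matrix (BIdx K r S) (MIdx K r) k) = Dl k K r S g * (M : Matrix (BIdx K r S) (MIdx K r) k) * Dr k K r h

/-- Two left ideals `L, L'` of a ring `A` are conjugate if `L' = u L u⁻¹` for a unit `u`. -/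
def ConjLeftIdeal (A : Type) [Ring A] (L L' : Submodule A A) : Prop :=
  ∃ u : Aˣ, (L' : Set A) = (fun x => (u : A) * x * ((u⁻¹ : Aˣ) : A)) '' (L : Set A)

/-- `A` has finitely many conjugacy classes of left ideals. -/
def HasFinitelyManyConjClassesOfLeftIdeals (A : Type) [Ring A] : Prop :=
  Finite (Quot (ConjLeftIdeal A))

/-! ### Linear algebra over a field -/

/-- Two linear maps with the same kernel differ by an automorphism of a finite-dimensional
codomain. -/
theorem LinearMap.exists_linearEquiv_comp_eq_of_ker_eq {k V W : Type*} [Field k]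
    [AddCommGroup V] [Module k V] [AddCommGroup W] [Module k W] [FiniteDimensional k W]
    (f g : V →ₗ[k] W) (h : LinearMap.ker f = LinearMap.ker g) :
    ∃ φ : W ≃ₗ[k] W, ∀ v, φ (f v) = g v := by
  obtain ⟨P, hP⟩ := (LinearMap.range f).exists_isCompl
  obtain ⟨Q, hQ⟩ := (LinearMap.range g).exists_isCompl
  let e : LinearMap.range f ≃ₗ[k] LinearMap.range g :=
    f.quotKerEquivRange.symm ≪≫ₗ Submodule.quotEquivOfEq _ _ h ≪≫ₗ g.quotKerEquivRange
  have he : ∀ v, e ⟨f v, v, rfl⟩ = ⟨g v, v, rfl⟩ := by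
    intro v
    have h1 : f.quotKerEquivRange.symm ⟨f v, v, rfl⟩ = Submodule.Quotient.mk v := by
      rw [LinearEquiv.symm_apply_eq]
      rfl
    simp only [e, LinearEquiv.trans_apply, h1]
    rfl
  have hfin : Module.finrank k P = Module.finrank k Q := by
    have h1 := Submodule.finrank_add_eq_of_isCompl hP
    have h2 := Submodule.finrank_add_eq_of_isCompl hQ
    have h3 := e.finrank_eq
    omega
  let c : P ≃ₗ[k] Q := LinearEquiv.ofFinrankEq _ _ hfin
  refine ⟨(Submodule.prodEquivOfIsCompl _ _ hP).symm ≪≫ₗ (e.prodCongr c) ≪≫ₗ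
    Submodule.prodEquivOfIsCompl _ _ hQ, fun v => ?_⟩
  have h1 : (Submodule.prodEquivOfIsCompl _ _ hP).symm (f v) = (⟨f v, v, rfl⟩, 0) := by
    rw [LinearEquiv.symm_apply_eq]
    simp
  simp [h1, he]

namespace Matrix

variable {k : Type*} [Field k]

theorem exists_GL_mul_eq_of_mulVec {m n : Type*} [Fintype m] [DecidableEq m] [Fintype n]
    (F G : Matrix m n k) (h : ∀ v, F *ᵥ v = 0 ↔ G *ᵥ v = 0) :
    ∃ g : GL m k, G = (g : Matrix m m k) * F := by
  classical
  obtain ⟨φ, hφ⟩ := LinearMap.exists_linearEquiv_comp_eq_of_ker_eq F.mulVecLin G.mulVecLin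
    (by ext v; simpa using h v)
  refine ⟨⟨LinearMap.toMatrix' φ.toLinearMap, LinearMap.toMatrix' φ.symm.toLinearMap, ?_, ?_⟩, ?_⟩
  · rw [← LinearMap.toMatrix'_comp]; simp
  · rw [← LinearMap.toMatrix'_comp]; simp
  · refine Matrix.mulVec_injective (funext fun v => ?_)
    rw [← Matrix.mulVec_mulVec]
    exact ((LinearMap.toMatrix'_mulVec _ _).trans (hφ v)).symm

theorem exists_mul_GL_eq_of_vecMul {m n : Type*} [Fintype m] [Fintype n] [DecidableEq n]
    (F G : Matrix m n k) (h : ∀ v, v ᵥ* F = 0 ↔ v ᵥ* G = 0) :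
    ∃ g : GL n k, G = F * (g : Matrix n n k) := by
  obtain ⟨g, hg⟩ := exists_GL_mul_eq_of_mulVec Fᵀ Gᵀ
    (by simpa only [Matrix.mulVec_transpose] using h)
  have hg' := congrArg Matrix.transpose hg
  simp only [transpose_mul, transpose_transpose] at hg'
  refine ⟨⟨(g : Matrix n n k)ᵀ, ((g⁻¹ : GL n k) : Matrix n n k)ᵀ, ?_, ?_⟩, hg'⟩
  · rw [← transpose_mul, Units.inv_mul, transpose_one]
  · rw [← transpose_mul, Units.mul_inv, transpose_one]

/-- If `E` is idempotent and annihilates `F` and `F * h` from the right, then `h` may be modified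
to an invertible matrix acting trivially on the row space of `E`. -/
theorem exists_mul_GL_eq_and_idempotent_mul_eq {m n : Type*} [Fintype m] [Fintype n]
    [DecidableEq n] (F G : Matrix m n k) (E : Matrix n n k) (h : GL n k) (hE : E * E = E)
    (hF : F * E = 0) (hG : G * E = 0) (hFG : G = F * (h : Matrix n n k)) :
    ∃ g : GL n k, G = F * (g : Matrix n n k) ∧ E * (g : Matrix n n k) = E := by
  have split : ∀ H : Matrix m n k, H * E = 0 → ∀ (x : m → k) (y : n → k),
      (x ᵥ* H + y ᵥ* E = 0 ↔ x ᵥ* H = 0 ∧ y ᵥ* E = 0) := by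
    refine fun H hH x y => ⟨fun hxy => ?_, fun hxy => by simp [hxy]⟩
    have h1 := congrArg (· ᵥ* E) hxy
    simp only [add_vecMul, vecMul_vecMul, hH, hE, vecMul_zero, zero_add, zero_vecMul] at h1
    exact ⟨by simpa [h1] using hxy, h1⟩
  have hker : ∀ x, x ᵥ* F = 0 ↔ x ᵥ* G = 0 := by
    refine fun x => ⟨fun hx => by rw [hFG, ← vecMul_vecMul, hx, zero_vecMul], fun hx => ?_⟩
    have : F = G * ((h⁻¹ : GL n k) : Matrix n n k) := by
      rw [hFG, Matrix.mul_assoc, Units.mul_inv, Matrix.mul_one]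
    rw [this, ← vecMul_vecMul, hx, zero_vecMul]
  obtain ⟨g, hg⟩ := exists_mul_GL_eq_of_vecMul (fromRows F E) (fromRows G E) (by
    intro v
    rw [← Sum.elim_comp_inl_inr v, sumElim_vecMul_fromRows, sumElim_vecMul_fromRows,
      split F hF, split G hG, hker])
  rw [fromRows_mul, fromRows_inj.eq_iff] at hg
  exact ⟨g, hg.1, hg.2.symm⟩

/-- Every square matrix is equivalent to a diagonal idempotent. -/
theorem exists_GL_mul_diagonal_indicator_mul_GL {n : Type*} [Fintype n] [DecidableEq n]
    (F : Matrix n n k) :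
    ∃ (a b : GL n k) (T : Set n), F = (a : Matrix n n k) * diagonal (T.indicator 1) *
      (b : Matrix n n k) := by
  classical
  obtain ⟨L, L', D, hD⟩ := Pivot.exists_list_transvec_mul_diagonal_mul_list_transvec F
  have hL : ∀ L : List (TransvectionStruct n k),
      IsUnit (L.map TransvectionStruct.toMatrix).prod := fun L => by
    rw [isUnit_iff_isUnit_det, TransvectionStruct.det_toMatrix_prod]
    exact isUnit_one
  have hd : IsUnit (diagonal fun i => if D i = 0 then 1 else D i) := by
    rw [isUnit_diagonal, Pi.isUnit_iff]
    intro i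
    split_ifs with h <;> simp [h]
  refine ⟨(hL L).unit * hd.unit, (hL L').unit, {i | D i ≠ 0}, ?_⟩
  rw [hD, Units.val_mul, IsUnit.unit_spec, IsUnit.unit_spec, IsUnit.unit_spec,
    Matrix.mul_assoc _ (diagonal _) (diagonal _), diagonal_mul_diagonal]
  congr 3
  ext i
  by_cases h : D i = 0 <;> simp [h]

end Matrix

/-! ### Block matrices -/

namespace Matrix

theorem ext_submatrix_sigma {k ι m : Type*} {α : ι → Type*} {M N : Matrix m (Σ i, α i) k}
    (h : ∀ j, M.submatrix id (Sigma.mk j) = N.submatrix id (Sigma.mk j)) : M = N := by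
  ext p ⟨j, t⟩
  exact congrFun (congrFun (h j) p) t

section Block

variable {k : Type*} [Field k] {ι : Type*}

/-- The `(i, j)` block of `X` vanishes unless `R i j`. -/
def BlockSupported {α β : ι → Type*} (R : ι → ι → Prop)
    (X : Matrix (Σ i, α i) (Σ i, β i) k) : Prop :=
  ∀ p q, ¬ R p.1 q.1 → X p q = 0

namespace BlockSupported

variable {α β γ : ι → Type*} {R : ι → ι → Prop}

theorem zero : BlockSupported R (0 : Matrix (Σ i, α i) (Σ i, β i) k) := fun _ _ _ => rfl

theorem add {X Y : Matrix (Σ i, α i) (Σ i, β i) k} (hX : BlockSupported R X)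
    (hY : BlockSupported R Y) : BlockSupported R (X + Y) := fun p q h => by
  simp [hX p q h, hY p q h]

theorem neg {X : Matrix (Σ i, α i) (Σ i, β i) k} (hX : BlockSupported R X) :
    BlockSupported R (-X) := fun p q h => by
  simp [hX p q h]

theorem blockDiag_mul [Fintype ι] [∀ i, Fintype (β i)] {C : Matrix (Σ i, α i) (Σ i, β i) k}
    {X : Matrix (Σ i, β i) (Σ i, γ i) k} (hC : BlockSupported Eq C) (hX : BlockSupported R X) :
    BlockSupported R (C * X) := fun p q h => by
  rw [mul_apply]
  refine Finset.sum_eq_zero fun x _ => ?_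
  by_cases hx : p.1 = x.1
  · rw [hX x q (hx ▸ h), mul_zero]
  · rw [hC p x hx, zero_mul]

theorem mul_blockDiag [Fintype ι] [∀ i, Fintype (β i)] {X : Matrix (Σ i, α i) (Σ i, β i) k}
    {C : Matrix (Σ i, β i) (Σ i, γ i) k} (hX : BlockSupported R X) (hC : BlockSupported Eq C) :
    BlockSupported R (X * C) := fun p q h => by
  rw [mul_apply]
  refine Finset.sum_eq_zero fun x _ => ?_
  by_cases hx : x.1 = q.1
  · rw [hX p x (hx.symm ▸ h), zero_mul]
  · rw [hC x q hx, mul_zero]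

theorem blockDiagonal' [DecidableEq ι] (X : ∀ i, Matrix (α i) (β i) k) :
    BlockSupported Eq (Matrix.blockDiagonal' X) := fun p q h => by
  rw [blockDiagonal'_apply, dif_neg h]

theorem eq_blockDiagonal' [DecidableEq ι] {X : Matrix (Σ i, α i) (Σ i, β i) k}
    (hX : BlockSupported Eq X) : X = Matrix.blockDiagonal' (blockDiag' X) := by
  ext ⟨i, s⟩ ⟨j, t⟩
  by_cases h : i = j
  · subst h
    rw [blockDiagonal'_apply_eq, blockDiag'_apply]
  · rw [hX _ _ h, blockDiagonal'_apply_ne _ _ _ h]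

theorem one [DecidableEq ι] [∀ i, DecidableEq (α i)] :
    BlockSupported Eq (1 : Matrix (Σ i, α i) (Σ i, α i) k) := fun _ _ h =>
  one_apply_ne fun hpq => h (hpq ▸ rfl)

theorem single [DecidableEq ι] [∀ i, DecidableEq (α i)] [∀ i, DecidableEq (β i)]
    (i : ι) (s : α i) (t : β i) (c : k) :
    BlockSupported Eq (Matrix.single (⟨i, s⟩ : Σ i, α i) (⟨i, t⟩ : Σ i, β i) c) := fun p q h => by
  rw [single_apply, if_neg]
  rintro ⟨rfl, rfl⟩
  exact h rfl

/-- A row of `C * G` with `C` block diagonal is a combination of the rows of `G` in the same block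
row. -/
theorem blockDiag_mul_row [Fintype ι] [DecidableEq ι] [∀ i, Fintype (β i)] {n : Type*}
    {C : Matrix (Σ i, α i) (Σ i, β i) k} (hC : BlockSupported Eq C)
    (G : Matrix (Σ i, β i) n k) (p : Σ i, α i) :
    (C * G) p = ∑ s : β p.1, C p ⟨p.1, s⟩ • G ⟨p.1, s⟩ := by
  ext q
  rw [mul_apply, Fintype.sum_sigma, Finset.sum_eq_single p.1, Finset.sum_apply]
  · rfl
  · exact fun j _ hj => Finset.sum_eq_zero fun s _ => by rw [hC _ _ (Ne.symm hj), zero_mul]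
  · exact fun h => absurd (Finset.mem_univ _) h

theorem exists_GL [DecidableEq ι] [Fintype ι] [∀ i, Fintype (α i)] [∀ i, DecidableEq (α i)]
    {P Q : Matrix (Σ i, α i) (Σ i, α i) k} (hP : BlockSupported Eq P) (hQ : BlockSupported Eq Q)
    (hPQ : P * Q = 1) (hQP : Q * P = 1) :
    ∃ h : ∀ i, GL (α i) k, P = Matrix.blockDiagonal' fun i => (h i : Matrix (α i) (α i) k) := by
  rw [hP.eq_blockDiagonal', hQ.eq_blockDiagonal', ← blockDiagonal'_mul, ← blockDiagonal'_one,
    blockDiagonal'_inj, funext_iff] at hPQ hQP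
  exact ⟨fun i => ⟨_, _, hPQ i, hQP i⟩, hP.eq_blockDiagonal'⟩

end BlockSupported

theorem submatrix_mul_blockDiagonal' [DecidableEq ι] [Fintype ι] {m : Type*} {α β : ι → Type*}
    [∀ i, Fintype (α i)] (M : Matrix m (Σ i, α i) k) (D : ∀ i, Matrix (α i) (β i) k) (j : ι) :
    (M * blockDiagonal' D).submatrix id (Sigma.mk j) = M.submatrix id (Sigma.mk j) * D j := by
  ext p t
  rw [submatrix_apply, mul_apply, mul_apply, Fintype.sum_sigma, Finset.sum_eq_single j]
  · simp
  · exact fun i _ hi => Finset.sum_eq_zero fun s _ => by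
      rw [blockDiagonal'_apply_ne _ _ _ hi, mul_zero]
  · exact fun h => absurd (Finset.mem_univ _) h

theorem submatrix_blockDiagonal'_mul [DecidableEq ι] [Fintype ι] {m : Type*} {α β : ι → Type*}
    [∀ i, Fintype (β i)] (D : ∀ i, Matrix (α i) (β i) k) (M : Matrix (Σ i, β i) m k) (i : ι) :
    (blockDiagonal' D * M).submatrix (Sigma.mk i) id = D i * M.submatrix (Sigma.mk i) id := by
  apply transpose_injective
  simpa [transpose_submatrix, transpose_mul, blockDiagonal'_transpose] using
    submatrix_mul_blockDiagonal' Mᵀ (fun i => (D i)ᵀ) i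

/-- Block version of `Matrix.exists_mul_GL_eq_and_idempotent_mul_eq`. -/
theorem exists_mul_blockDiagonal'_GL_eq [DecidableEq ι] [Fintype ι] {m : Type*} [Fintype m]
    {α : ι → Type*} [∀ i, Fintype (α i)] [∀ i, DecidableEq (α i)] (F G : Matrix m (Σ i, α i) k)
    (E : ∀ i, Matrix (α i) (α i) k) (h : ∀ i, GL (α i) k) (hE : ∀ i, E i * E i = E i)
    (hF : F * blockDiagonal' E = 0) (hG : G * blockDiagonal' E = 0)
    (hFG : G = F * blockDiagonal' fun i => (h i : Matrix (α i) (α i) k)) :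
    ∃ g : ∀ i, GL (α i) k, G = F * blockDiagonal' (fun i => (g i : Matrix (α i) (α i) k)) ∧
      blockDiagonal' E * blockDiagonal' (fun i => (g i : Matrix (α i) (α i) k)) =
        blockDiagonal' E := by
  have block : ∀ j, ∃ g : GL (α j) k, G.submatrix id (Sigma.mk j) =
      F.submatrix id (Sigma.mk j) * (g : Matrix (α j) (α j) k) ∧
        E j * (g : Matrix (α j) (α j) k) = E j := fun j => by
    refine exists_mul_GL_eq_and_idempotent_mul_eq _ _ (E j) (h j) (hE j) ?_ ?_ ?_
    · rw [← submatrix_mul_blockDiagonal', hF]; rfl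
    · rw [← submatrix_mul_blockDiagonal', hG]; rfl
    · rw [← submatrix_mul_blockDiagonal' F (fun i => (h i : Matrix (α i) (α i) k)), ← hFG]
  choose g hg hEg using block
  refine ⟨g, ext_submatrix_sigma fun j => ?_, ?_⟩
  · rw [submatrix_mul_blockDiagonal', hg]
  · rw [← blockDiagonal'_mul]
    simp_rw [hEg]

end Block

end Matrix

/-- A submodule of finrank at most `m` is the image of `Fin m → k`. -/
theorem Submodule.exists_surjective_of_finrank_le {k V : Type*} [Field k] [AddCommGroup V]
    [Module k V] [FiniteDimensional k V] (m : ℕ) (h : Module.finrank k V ≤ m) :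
    ∃ f : (Fin m → k) →ₗ[k] V, Function.Surjective f :=
  ⟨((Module.finBasis k V).equivFun.symm : _ →ₗ[k] V) ∘ₗ LinearMap.funLeft k k (Fin.castLE h),
    (Module.finBasis k V).equivFun.symm.surjective.comp
      (LinearMap.funLeft_surjective_of_injective _ _ _ (Fin.castLE_injective h))⟩

namespace Matrix

/-- A space of block matrices stable under left multiplication by block-diagonal matrices consists
of the block-diagonal left multiples of a single matrix, as soon as the block rows of the latter
are high enough. -/
theorem exists_forall_mem_iff_eq_blockDiag_mul {k ι : Type*} [Field k] [Fintype ι] [DecidableEq ι]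
    {α β : ι → Type*} [∀ i, Fintype (α i)] [∀ i, DecidableEq (α i)] [∀ i, Nonempty (α i)]
    [∀ i, Fintype (β i)] (R : ι → ι → Prop) (m : ι → ℕ)
    (hm : ∀ i, Nat.card {q : Σ j, β j // R i q.1} ≤ m i)
    (N : Submodule k (Matrix (Σ i, α i) (Σ i, β i) k)) (hN : ∀ X ∈ N, BlockSupported R X)
    (hmul : ∀ C : Matrix (Σ i, α i) (Σ i, α i) k, BlockSupported Eq C → ∀ X ∈ N, C * X ∈ N) :
    ∃ G : Matrix (Σ i, Fin (m i)) (Σ i, β i) k, BlockSupported R G ∧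
      ∀ X, X ∈ N ↔ ∃ C : Matrix (Σ i, α i) (Σ i, Fin (m i)) k, BlockSupported Eq C ∧ X = C * G := by
  let W (i : ι) : Submodule k ((Σ i, β i) → k) :=
    { carrier := {w | ∀ t : α i, vecMulVec (Pi.single (⟨i, t⟩ : Σ i, α i) 1) w ∈ N}
      add_mem' := fun ha hb t => by
        rw [vecMulVec_add]
        exact N.add_mem (ha t) (hb t)
      zero_mem' := fun t => by
        convert N.zero_mem
        ext
        simp [vecMulVec_apply]
      smul_mem' := fun c a ha t => by
        rw [vecMulVec_smul]
        exact N.smul_mem c (ha t) }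
  have hW : ∀ i, ∀ w ∈ W i, ∀ q, ¬ R i q.1 → w q = 0 := fun i w hw q hq => by
    obtain ⟨t⟩ := ‹∀ i, Nonempty (α i)› i
    simpa [vecMulVec_apply] using hN _ (hw t) ⟨i, t⟩ q hq
  have row_mem : ∀ X ∈ N, ∀ p, X p ∈ W p.1 := fun X hX p t => by
    convert hmul _ (BlockSupported.single p.1 t p.2 (1 : k)) X hX using 1
    ext x q
    by_cases hx : (⟨p.1, t⟩ : Σ i, α i) = x
    · subst hx
      simp [vecMulVec_apply]
    · rw [single_mul_apply_of_ne _ _ _ _ _ (Ne.symm hx), vecMulVec_apply,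
        Pi.single_eq_of_ne (Ne.symm hx), zero_mul]
  have mem_of_row : ∀ X, (∀ p, X p ∈ W p.1) → X ∈ N := fun X hX => by
    have : X = ∑ p, vecMulVec (Pi.single p 1) (X p) := by
      ext x q
      rw [sum_apply, Finset.sum_eq_single x]
      · simp [vecMulVec_apply]
      · intro p _ hp
        rw [vecMulVec_apply, Pi.single_eq_of_ne (Ne.symm hp), zero_mul]
      · exact fun h => absurd (Finset.mem_univ _) h
    rw [this]
    exact N.sum_mem fun p _ => hX p p.2
  have hrank : ∀ i, Module.finrank k (W i) ≤ m i := fun i => by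
    classical
    refine le_trans ?_ (hm i)
    rw [Nat.card_eq_fintype_card, ← Module.finrank_fintype_fun_eq_card k]
    refine LinearMap.finrank_le_finrank_of_injective
      (f := LinearMap.funLeft k k (Subtype.val : {q : Σ j, β j // R i q.1} → _) ∘ₗ (W i).subtype) ?_
    rw [← LinearMap.ker_eq_bot, LinearMap.ker_eq_bot']
    intro w hw
    ext q
    by_cases hq : R i q.1
    · exact congrFun hw ⟨q, hq⟩
    · exact hW i w w.2 q hq
  choose f hf using fun i => Submodule.exists_surjective_of_finrank_le (m i) (hrank i)
  let G : Matrix (Σ i, Fin (m i)) (Σ i, β i) k := fun p => f p.1 (Pi.single p.2 1)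
  refine ⟨G, fun p q h => hW _ _ (f p.1 _).2 q h, fun X => ⟨fun hX => ?_, ?_⟩⟩
  · choose c hc using fun p => hf p.1 ⟨X p, row_mem X hX p⟩
    let C : Matrix (Σ i, α i) (Σ i, Fin (m i)) k :=
      fun p q => (Pi.single p.1 (c p) : ∀ i, Fin (m i) → k) q.1 q.2
    have hC : BlockSupported Eq C := fun p q h => by
      simp [C, Pi.single_eq_of_ne (Ne.symm h)]
    refine ⟨C, hC, funext fun p => ?_⟩
    rw [hC.blockDiag_mul_row]
    have := congrArg Subtype.val (hc p)
    rw [← Finset.univ_sum_single (c p), map_sum, Submodule.coe_sum] at this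
    refine this.symm.trans (Finset.sum_congr rfl fun s _ => ?_)
    rw [← mul_one (c p s), ← smul_eq_mul, Pi.single_smul, map_smul]
    simp [C, G]
  · rintro ⟨C, hC, rfl⟩
    refine mem_of_row _ fun p => ?_
    rw [hC.blockDiag_mul_row]
    exact Submodule.sum_mem _ fun s _ => Submodule.smul_mem _ _ (f p.1 _).2

end Matrix

/-! ### The groups `G_l` and `G_r` -/

section Groups

open Matrix

variable {k : Type} [Field k] {K : ℕ} {r : Fin K → ℕ} {S : Set (Fin K × Fin K)}

theorem Dr_blockSupported (h : ∀ i, GL (Fin (r i)) k) : BlockSupported Eq (Dr k K r h) :=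
  BlockSupported.blockDiagonal' _

theorem Dr_mul (g h : ∀ i, GL (Fin (r i)) k) : Dr k K r g * Dr k K r h = Dr k K r (g * h) :=
  (blockDiagonal'_mul _ _).symm

theorem Dr_one : Dr k K r 1 = 1 :=
  blockDiagonal'_one

theorem Dr_mul_inv (h : ∀ i, GL (Fin (r i)) k) : Dr k K r h * Dr k K r h⁻¹ = 1 := by
  rw [Dr_mul, mul_inv_cancel, Dr_one]

theorem Dr_inv_mul (h : ∀ i, GL (Fin (r i)) k) : Dr k K r h⁻¹ * Dr k K r h = 1 := by
  rw [Dr_mul, inv_mul_cancel, Dr_one]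

variable [DecidablePred (· ∈ S)]

theorem Dl_blockSupported (g : ∀ i, GL (Fin (aDim K r S i)) k) :
    BlockSupported Eq (Dl k K r S g) :=
  BlockSupported.blockDiagonal' _

theorem Dl_mul (g h : ∀ i, GL (Fin (aDim K r S i)) k) :
    Dl k K r S g * Dl k K r S h = Dl k K r S (g * h) :=
  (blockDiagonal'_mul _ _).symm

theorem Dl_one : Dl k K r S 1 = 1 :=
  blockDiagonal'_one

theorem Dl_inv_mul (g : ∀ i, GL (Fin (aDim K r S i)) k) :
    Dl k K r S g⁻¹ * Dl k K r S g = 1 := by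
  rw [Dl_mul, inv_mul_cancel, Dl_one]

theorem doubleCosetRel_equivalence : Equivalence (DoubleCosetRel k K r S) where
  refl M := ⟨1, 1, by rw [Dl_one, Dr_one, Matrix.one_mul, Matrix.mul_one]⟩
  symm := by
    rintro M M' ⟨g, h, hM⟩
    refine ⟨g⁻¹, h⁻¹, ?_⟩
    rw [hM, Matrix.mul_assoc, Matrix.mul_assoc _ (Dr k K r h), Dr_mul_inv, Matrix.mul_one,
      ← Matrix.mul_assoc, Dl_inv_mul, Matrix.one_mul]
  trans := by
    rintro M M' M'' ⟨g, h, hM⟩ ⟨g', h', hM'⟩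
    refine ⟨g' * g, h * h', ?_⟩
    rw [hM', hM, ← Dl_mul, ← Dr_mul]
    simp only [Matrix.mul_assoc]

end Groups

/-! ### The model algebra -/

namespace ModelAlgebra

open Matrix

variable {k : Type} [Field k] {K : ℕ} {r : Fin K → ℕ} {S : Set (Fin K × Fin K)}

/-- The matrix of constant terms. -/
def const (x : ↥(ModelAlgebra k K r S)) : Matrix (MIdx K r) (MIdx K r) k :=
  fun p q => ((x : Matrix (MIdx K r) (MIdx K r) (DualNumber k)) p q).fst

/-- The matrix of `x`-coefficients. -/
def coeff (x : ↥(ModelAlgebra k K r S)) : Matrix (MIdx K r) (MIdx K r) k :=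
  fun p q => ((x : Matrix (MIdx K r) (MIdx K r) (DualNumber k)) p q).snd

theorem const_blockSupported (x : ↥(ModelAlgebra k K r S)) : BlockSupported Eq (const x) :=
  fun p q h => (x.2 p q).1 h

theorem coeff_blockSupported (x : ↥(ModelAlgebra k K r S)) :
    BlockSupported (fun i j => (i, j) ∈ S) (coeff x) :=
  fun p q h => (x.2 p q).2 h

theorem ext {x y : ↥(ModelAlgebra k K r S)} (h₁ : const x = const y) (h₂ : coeff x = coeff y) :
    x = y :=
  Subtype.ext <| Matrix.ext fun p q =>
    TrivSqZeroExt.ext (congrFun (congrFun h₁ p) q) (congrFun (congrFun h₂ p) q)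

@[simp] theorem const_add (x y : ↥(ModelAlgebra k K r S)) : const (x + y) = const x + const y := rfl

@[simp] theorem coeff_add (x y : ↥(ModelAlgebra k K r S)) : coeff (x + y) = coeff x + coeff y := rfl

@[simp] theorem const_sub (x y : ↥(ModelAlgebra k K r S)) : const (x - y) = const x - const y := rfl

@[simp] theorem coeff_sub (x y : ↥(ModelAlgebra k K r S)) : coeff (x - y) = coeff x - coeff y := rfl

@[simp] theorem coeff_zero : coeff (0 : ↥(ModelAlgebra k K r S)) = 0 := rfl

@[simp] theorem const_one : const (1 : ↥(ModelAlgebra k K r S)) = 1 := by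
  ext p q
  by_cases h : p = q
  · subst h; simp [const]
  · simp [const, h]

@[simp] theorem coeff_one : coeff (1 : ↥(ModelAlgebra k K r S)) = 0 := by
  ext p q
  by_cases h : p = q
  · subst h; simp [coeff]
  · simp [coeff, h]

@[simp] theorem const_mul (x y : ↥(ModelAlgebra k K r S)) :
    const (x * y) = const x * const y := by
  ext p q
  simp [const, Matrix.mul_apply, TrivSqZeroExt.fst_sum]

@[simp] theorem coeff_mul (x y : ↥(ModelAlgebra k K r S)) :
    coeff (x * y) = const x * coeff y + coeff x * const y := by
  ext p q
  simp [const, coeff, Matrix.mul_apply, TrivSqZeroExt.snd_sum, Finset.sum_add_distrib]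

/-- The element with given constant terms and `x`-coefficients. -/
def mk (P X : Matrix (MIdx K r) (MIdx K r) k) (hP : BlockSupported Eq P)
    (hX : BlockSupported (fun i j => (i, j) ∈ S) X) : ↥(ModelAlgebra k K r S) :=
  ⟨fun p q => (P p q, X p q), fun p q => ⟨hP p q, hX p q⟩⟩

@[simp] theorem const_mk (P X : Matrix (MIdx K r) (MIdx K r) k) (hP : BlockSupported Eq P)
    (hX : BlockSupported (fun i j => (i, j) ∈ S) X) : const (mk P X hP hX) = P := rfl

@[simp] theorem coeff_mk (P X : Matrix (MIdx K r) (MIdx K r) k) (hP : BlockSupported Eq P)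
    (hX : BlockSupported (fun i j => (i, j) ∈ S) X) : coeff (mk P X hP hX) = X := rfl

/-- The invertible block-diagonal matrix with given blocks, as a unit. -/
def diagUnit (h : ∀ i, GL (Fin (r i)) k) : (↥(ModelAlgebra k K r S))ˣ where
  val := mk (Dr k K r h) 0 (Dr_blockSupported h) BlockSupported.zero
  inv := mk (Dr k K r h⁻¹) 0 (Dr_blockSupported h⁻¹) BlockSupported.zero
  val_inv := ext (by simp [Dr_mul_inv]) (by simp)
  inv_val := ext (by simp [Dr_inv_mul]) (by simp)

/-- The unit `1 + x X`. -/
def unipotentUnit (X : Matrix (MIdx K r) (MIdx K r) k)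
    (hX : BlockSupported (fun i j => (i, j) ∈ S) X) : (↥(ModelAlgebra k K r S))ˣ where
  val := mk 1 X BlockSupported.one hX
  inv := mk 1 (-X) BlockSupported.one hX.neg
  val_inv := ext (by simp) (by simp)
  inv_val := ext (by simp) (by simp)

theorem exists_const_unit_eq (u : (↥(ModelAlgebra k K r S))ˣ) :
    ∃ h : ∀ i, GL (Fin (r i)) k, const (u : ↥(ModelAlgebra k K r S)) = Dr k K r h :=
  BlockSupported.exists_GL (Q := const (u⁻¹ : (↥(ModelAlgebra k K r S))ˣ).val)
    (const_blockSupported _) (const_blockSupported _)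
    (by rw [← const_mul, u.mul_inv, const_one]) (by rw [← const_mul, u.inv_mul, const_one])

end ModelAlgebra

/-! ### Left ideals up to right multiplication by units -/

theorem conjLeftIdeal_iff {A : Type} [Ring A] {L L' : Submodule A A} :
    ConjLeftIdeal A L L' ↔ ∃ v : Aˣ, ∀ x, x ∈ L ↔ x * v ∈ L' := by
  constructor
  · rintro ⟨u, hu⟩
    refine ⟨u⁻¹, fun x => ?_⟩
    rw [← SetLike.mem_coe (p := L'), hu]
    constructor
    · exact fun hx => ⟨(u⁻¹ : Aˣ) * x, L.smul_mem _ hx, by simp [← mul_assoc]⟩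
    · rintro ⟨y, hy, hyx⟩
      rw [← (u⁻¹.isUnit.mul_left_injective hyx : (u : A) * y = x)]
      exact L.smul_mem _ hy
  · rintro ⟨v, hv⟩
    refine ⟨v⁻¹, Set.ext fun x => ⟨fun hx => ⟨v * x * ↑v⁻¹, ?_, by simp [mul_assoc]⟩, ?_⟩⟩
    · rw [SetLike.mem_coe, hv, Units.inv_mul_cancel_right]
      exact L'.smul_mem _ hx
    · rintro ⟨y, hy, rfl⟩
      simp only [inv_inv, mul_assoc, SetLike.mem_coe]
      exact L'.smul_mem _ ((hv y).1 hy)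

theorem conjLeftIdeal_equivalence (A : Type) [Ring A] : Equivalence (ConjLeftIdeal A) where
  refl L := conjLeftIdeal_iff.2 ⟨1, by simp⟩
  symm {L L'} h := by
    obtain ⟨v, hv⟩ := conjLeftIdeal_iff.1 h
    exact conjLeftIdeal_iff.2 ⟨v⁻¹, fun x => by rw [hv, Units.inv_mul_cancel_right]⟩
  trans {L L' L''} h h' := by
    obtain ⟨v, hv⟩ := conjLeftIdeal_iff.1 h
    obtain ⟨w, hw⟩ := conjLeftIdeal_iff.1 h'
    exact conjLeftIdeal_iff.2 ⟨v * w, fun x => by rw [hv, hw, Units.val_mul, mul_assoc]⟩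

/-! ### Left ideals and diagonal idempotents -/

namespace ModelAlgebra

open Matrix

variable {k : Type} [Field k] {K : ℕ} {r : Fin K → ℕ} {S : Set (Fin K × Fin K)}

/-- The diagonal idempotent of `A` supported on `T`. -/
noncomputable def diagIdempotent (k : Type) [Field k] {K : ℕ} {r : Fin K → ℕ}
    (T : ∀ i, Set (Fin (r i))) :
    Matrix (MIdx K r) (MIdx K r) k :=
  blockDiagonal' fun i => diagonal ((T i).indicator 1)


theorem diagonal_indicator_mul_self {n : Type*} [Fintype n] [DecidableEq n] (T : Set n) :
    diagonal (T.indicator (1 : n → k)) * diagonal (T.indicator 1) = diagonal (T.indicator 1) := by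
  rw [diagonal_mul_diagonal]
  congr 1
  ext i
  by_cases h : i ∈ T <;> simp [h]

theorem diagIdempotent_blockSupported (T : ∀ i, Set (Fin (r i))) :
    BlockSupported Eq (diagIdempotent k T) :=
  BlockSupported.blockDiagonal' _

theorem diagIdempotent_mul_self (T : ∀ i, Set (Fin (r i))) :
    diagIdempotent k T * diagIdempotent k T = diagIdempotent k T := by
  rw [diagIdempotent, ← blockDiagonal'_mul]
  simp_rw [diagonal_indicator_mul_self]

/-- The matrices of constant terms of the elements of a left ideal. -/
def constSubmodule (L : Submodule ↥(ModelAlgebra k K r S) ↥(ModelAlgebra k K r S)) :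
    Submodule k (Matrix (MIdx K r) (MIdx K r) k) where
  carrier := {P | ∃ x ∈ L, const x = P}
  add_mem' := by
    rintro _ _ ⟨x, hx, rfl⟩ ⟨y, hy, rfl⟩
    exact ⟨x + y, L.add_mem hx hy, const_add x y⟩
  zero_mem' := ⟨0, L.zero_mem, rfl⟩
  smul_mem' := by
    rintro c _ ⟨x, hx, rfl⟩
    exact ⟨c • x, by simpa using L.smul_mem (c • 1) hx, by ext; simp [const]⟩

/-- The matrices of `x`-coefficients of the elements of a left ideal that lie in the radical and
are annihilated by `E` from the right. -/
def radicalSubmodule (L : Submodule ↥(ModelAlgebra k K r S) ↥(ModelAlgebra k K r S))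
    (E : Matrix (MIdx K r) (MIdx K r) k) : Submodule k (Matrix (MIdx K r) (MIdx K r) k) where
  carrier := {X | X * E = 0 ∧ ∃ x ∈ L, const x = 0 ∧ coeff x = X}
  add_mem' := by
    rintro _ _ ⟨hxE, x, hx, hx0, rfl⟩ ⟨hyE, y, hy, hy0, rfl⟩
    exact ⟨by rw [Matrix.add_mul, hxE, hyE, add_zero], x + y, L.add_mem hx hy,
      by simp [hx0, hy0], coeff_add x y⟩
  zero_mem' := ⟨Matrix.zero_mul _, 0, L.zero_mem, rfl, rfl⟩
  smul_mem' := by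
    rintro c _ ⟨hxE, x, hx, hx0, rfl⟩
    refine ⟨by rw [Matrix.smul_mul, hxE, smul_zero], c • x, by simpa using L.smul_mem (c • 1) hx,
      ?_, by ext; simp [coeff]⟩
    ext p q
    have : const x p q = 0 := by rw [hx0]; rfl
    simp only [const] at this
    simp [const, this]

theorem card_sigma_fst (p : Fin K → Prop) [DecidablePred p] :
    Nat.card {q : MIdx K r // p q.1} = ∑ j ∈ Finset.univ.filter p, r j := by
  rw [Nat.card_eq_fintype_card, Fintype.card_subtype,
    show (Finset.univ.filter fun q : MIdx K r => p q.1) =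
      (Finset.univ.filter p).sigma fun _ => Finset.univ by ext; simp, Finset.card_sigma]
  simp

/-- After right multiplication by a unit, a left ideal contains a diagonal idempotent of `A`
generating its image modulo the radical. -/
theorem exists_conj_diagIdempotent_mem (hr : ∀ i, 0 < r i)
    (L : Submodule ↥(ModelAlgebra k K r S) ↥(ModelAlgebra k K r S)) :
    ∃ (T : ∀ i, Set (Fin (r i)))
      (L' : Submodule ↥(ModelAlgebra k K r S) ↥(ModelAlgebra k K r S)),
      ConjLeftIdeal ↥(ModelAlgebra k K r S) L L' ∧
      mk (diagIdempotent k T) 0 (diagIdempotent_blockSupported T) BlockSupported.zero ∈ L' ∧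
      ∀ x ∈ L', const x * diagIdempotent k T = const x := by
  have : ∀ i, Nonempty (Fin (r i)) := fun i => ⟨⟨0, hr i⟩⟩
  obtain ⟨F, hF, hLF⟩ := exists_forall_mem_iff_eq_blockDiag_mul Eq r
    (fun i => by rw [card_sigma_fst]; simp [Finset.filter_eq]) (constSubmodule L)
    (by rintro _ ⟨x, -, rfl⟩; exact const_blockSupported x)
    (by
      rintro C hC _ ⟨x, hx, rfl⟩
      exact ⟨mk C 0 hC BlockSupported.zero * x, L.smul_mem _ hx, by simp⟩)
  choose a b T habT using fun i => exists_GL_mul_diagonal_indicator_mul_GL (blockDiag' F i)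
  have hFT : F = Dr k K r a * diagIdempotent k T * Dr k K r b := by
    rw [hF.eq_blockDiagonal', diagIdempotent, Dr, Dr, ← blockDiagonal'_mul, ← blockDiagonal'_mul]
    exact congrArg _ (funext habT)
  obtain ⟨x, hx, hxF⟩ := (hLF F).2 ⟨1, BlockSupported.one, (Matrix.one_mul F).symm⟩
  set E := diagIdempotent k T with hE
  have hEb : BlockSupported Eq E := diagIdempotent_blockSupported T
  have hEE : E * E = E := diagIdempotent_mul_self T
  let y : ↥(ModelAlgebra k K r S) := mk E 0 hEb BlockSupported.zero *
    (diagUnit a : (↥(ModelAlgebra k K r S))ˣ).inv * x * (diagUnit b : (↥(ModelAlgebra k K r S))ˣ).inv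
  have hy : const y = E := by
    have h1 : const y = E * Dr k K r a⁻¹ * const x * Dr k K r b⁻¹ := by
      simp only [y, const_mul, const_mk]
      rfl
    rw [h1, hxF, hFT]
    simp only [Matrix.mul_assoc, Dr_mul_inv, Matrix.mul_one]
    rw [← Matrix.mul_assoc (Dr k K r a⁻¹), Dr_inv_mul, Matrix.one_mul, hEE]
  have hyE : E * coeff y = coeff y := by
    have h1 : y = mk E 0 hEb BlockSupported.zero * y := by
      have : mk E 0 hEb BlockSupported.zero * mk E 0 hEb BlockSupported.zero =
          (mk E 0 hEb BlockSupported.zero : ↥(ModelAlgebra k K r S)) :=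
        ext (by simpa using hEE) (by simp)
      simp only [y, ← mul_assoc, this]
    conv_rhs => rw [h1]
    simp
  let v : (↥(ModelAlgebra k K r S))ˣ :=
    (diagUnit b)⁻¹ * unipotentUnit (-coeff y) (coeff_blockSupported y).neg
  have hv : y * (unipotentUnit (-coeff y) (coeff_blockSupported y).neg).val =
      mk E 0 hEb BlockSupported.zero :=
    ext (by simp [unipotentUnit, hy]) (by simp [unipotentUnit, hy, hyE])
  refine ⟨T, L.comap (LinearMap.toSpanSingleton _ _ ((v⁻¹ : (↥(ModelAlgebra k K r S))ˣ) :
    ↥(ModelAlgebra k K r S))), conjLeftIdeal_iff.2 ⟨v, fun z => ?_⟩, ?_, fun z hz => ?_⟩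
  · rw [Submodule.mem_comap, LinearMap.toSpanSingleton_apply, smul_eq_mul,
      Units.mul_inv_cancel_right]
  · rw [Submodule.mem_comap, LinearMap.toSpanSingleton_apply, smul_eq_mul, ← hv]
    have : y * (unipotentUnit (-coeff y) (coeff_blockSupported y).neg).val =
        mk E 0 hEb BlockSupported.zero *
        (diagUnit a : (↥(ModelAlgebra k K r S))ˣ).inv * x * v.val := by
      simp only [y, v, Units.val_mul, mul_assoc, Units.inv_eq_val_inv]
    rw [this, Units.mul_inv_cancel_right]
    exact L.smul_mem _ hx
  · rw [Submodule.mem_comap, LinearMap.toSpanSingleton_apply, smul_eq_mul] at hz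
    obtain ⟨C, -, hC⟩ := (hLF _).1 ⟨_, hz, rfl⟩
    have hvb : const (v : ↥(ModelAlgebra k K r S)) = Dr k K r b⁻¹ := by
      simp only [v, Units.val_mul, const_mul]
      exact Matrix.mul_one _
    have hz' : const z = C * Dr k K r a * E := by
      have h1 : const z = const (z * (v⁻¹).val) * const v.val := by
        rw [← const_mul, Units.inv_mul_cancel_right]
      rw [h1, hC, hvb, hFT]
      simp only [Matrix.mul_assoc, Dr_mul_inv, Matrix.mul_one]
    rw [hz', Matrix.mul_assoc, hEE]

/-! ### From orbits to left ideals contained in the radical -/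

variable [DecidablePred (· ∈ S)]

/-- The left ideal contained in the radical whose rows lie in the row spaces of the block rows
of `M`. -/
def rowIdeal (M : Matrix (BIdx K r S) (MIdx K r) k) :
    Submodule ↥(ModelAlgebra k K r S) ↥(ModelAlgebra k K r S) where
  carrier := {x | const x = 0 ∧ ∃ C : Matrix (MIdx K r) (BIdx K r S) k,
    BlockSupported Eq C ∧ coeff x = C * M}
  add_mem' := by
    rintro x y ⟨hx, C, hC, hxC⟩ ⟨hy, C', hC', hyC⟩
    exact ⟨by simp [hx, hy], C + C', hC.add hC', by simp [hxC, hyC, Matrix.add_mul]⟩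
  zero_mem' := ⟨rfl, 0, BlockSupported.zero, by simp⟩
  smul_mem' := by
    rintro a x ⟨hx, C, hC, hxC⟩
    exact ⟨by simp [hx], const a * C, (const_blockSupported a).blockDiag_mul hC,
      by simp [hx, hxC, Matrix.mul_assoc]⟩

theorem mem_rowIdeal {M : Matrix (BIdx K r S) (MIdx K r) k} {x : ↥(ModelAlgebra k K r S)} :
    x ∈ rowIdeal M ↔ const x = 0 ∧ ∃ C : Matrix (MIdx K r) (BIdx K r S) k,
      BlockSupported Eq C ∧ coeff x = C * M :=
  Iff.rfl

/-- If every block-diagonal left multiple of `F` is one of `G`, the kernels of the block rows of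
`G` are contained in those of `F`. -/
theorem mulVec_eq_zero_of_forall_exists (hr : ∀ i, 0 < r i)
    {F G : Matrix (BIdx K r S) (MIdx K r) k}
    (h : ∀ C : Matrix (MIdx K r) (BIdx K r S) k, BlockSupported Eq C →
      ∃ C' : Matrix (MIdx K r) (BIdx K r S) k, BlockSupported Eq C' ∧ C * F = C' * G)
    (i : Fin K) (v : MIdx K r → k) (hv : G.submatrix (Sigma.mk i) id *ᵥ v = 0) :
    F.submatrix (Sigma.mk i) id *ᵥ v = 0 := by
  funext s
  obtain ⟨C', hC', hFG⟩ := h _ (BlockSupported.single i (⟨0, hr i⟩ : Fin (r i)) s (1 : k))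
  have h1 := congrFun hFG ⟨i, ⟨0, hr i⟩⟩
  rw [hC'.blockDiag_mul_row] at h1
  have h2 : F ⟨i, s⟩ = ∑ t, C' ⟨i, ⟨0, hr i⟩⟩ ⟨i, t⟩ • G ⟨i, t⟩ := by
    rw [← h1]
    ext q
    simp
  have h3 : ∀ t, G ⟨i, t⟩ ⬝ᵥ v = 0 := fun t => congrFun hv t
  change F ⟨i, s⟩ ⬝ᵥ v = 0
  rw [h2, sum_dotProduct]
  exact Finset.sum_eq_zero fun t _ => by rw [smul_dotProduct, h3, smul_zero]

theorem doubleCosetRel_of_conj_rowIdeal (hr : ∀ i, 0 < r i)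
    (M M' : {M : Matrix (BIdx K r S) (MIdx K r) k // M ∈ MSet k K r S})
    (h : ConjLeftIdeal ↥(ModelAlgebra k K r S) (rowIdeal M.1) (rowIdeal M'.1)) :
    DoubleCosetRel k K r S M M' := by
  obtain ⟨v, hv⟩ := conjLeftIdeal_iff.1 h
  obtain ⟨h, hvh⟩ := exists_const_unit_eq v
  have supp : ∀ (N : {M : Matrix (BIdx K r S) (MIdx K r) k // M ∈ MSet k K r S}),
      BlockSupported (fun i j => (i, j) ∈ S) N.1 := fun N => N.2
  have h₁ : ∀ C : Matrix (MIdx K r) (BIdx K r S) k, BlockSupported Eq C →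
      ∃ C' : Matrix (MIdx K r) (BIdx K r S) k, BlockSupported Eq C' ∧
        C * (M.1 * Dr k K r h) = C' * M'.1 := fun C hC => by
    obtain ⟨-, C', hC', hCC'⟩ := mem_rowIdeal.1 <|
      (hv (mk 0 (C * M.1) BlockSupported.zero (hC.blockDiag_mul (supp M)))).1
        (mem_rowIdeal.2 ⟨rfl, C, hC, rfl⟩)
    refine ⟨C', hC', ?_⟩
    rw [← hCC']
    simp [hvh, Matrix.mul_assoc]
  have h₂ : ∀ C' : Matrix (MIdx K r) (BIdx K r S) k, BlockSupported Eq C' →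
      ∃ C : Matrix (MIdx K r) (BIdx K r S) k, BlockSupported Eq C ∧
        C' * M'.1 = C * (M.1 * Dr k K r h) := fun C' hC' => by
    have hmem := (hv (mk 0 (C' * M'.1 * Dr k K r h⁻¹) BlockSupported.zero
      ((hC'.blockDiag_mul (supp M')).mul_blockDiag (Dr_blockSupported _)))).2
        (mem_rowIdeal.2 ⟨by simp, C', hC', by
          simp [hvh, Matrix.mul_assoc, Dr_inv_mul]⟩)
    obtain ⟨-, C, hC, hCC'⟩ := mem_rowIdeal.1 hmem
    refine ⟨C, hC, ?_⟩
    rw [← Matrix.mul_assoc, ← hCC', coeff_mk, Matrix.mul_assoc, Dr_inv_mul, Matrix.mul_one]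
  have key : ∀ i, ∃ g : GL (Fin (aDim K r S i)) k, M'.1.submatrix (Sigma.mk i) id =
      (g : Matrix _ _ k) * (M.1 * Dr k K r h).submatrix (Sigma.mk i) id := fun i =>
    exists_GL_mul_eq_of_mulVec _ _ fun v =>
      ⟨mulVec_eq_zero_of_forall_exists hr h₂ i v, mulVec_eq_zero_of_forall_exists hr h₁ i v⟩
  choose g hg using key
  refine ⟨g, h, ?_⟩
  rw [Matrix.mul_assoc]
  ext ⟨i, s⟩ q
  have := (hg i).trans (submatrix_blockDiagonal'_mul
    (fun i => (g i : Matrix (Fin (aDim K r S i)) (Fin (aDim K r S i)) k)) _ i).symm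
  exact congrFun (congrFun this s) q

/-! ### Normal forms of left ideals -/

/-- A left ideal `L` is in normal form with data `T` and `M` if it consists of the elements whose
rows lie in the sum of the row spaces of `M` and of the diagonal idempotent supported on `T`. -/
structure IsNormalForm (T : ∀ i, Set (Fin (r i))) (M : Matrix (BIdx K r S) (MIdx K r) k)
    (L : Submodule ↥(ModelAlgebra k K r S) ↥(ModelAlgebra k K r S)) : Prop where
  mem_MSet : M ∈ MSet k K r S
  mul_eq_zero : M * diagIdempotent k T = 0
  mem_iff : ∀ x, x ∈ L ↔ const x * diagIdempotent k T = const x ∧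
    ∃ C : Matrix (MIdx K r) (BIdx K r S) k, BlockSupported Eq C ∧
      coeff x * (1 - diagIdempotent k T) = C * M

theorem IsNormalForm.mul_mem {T : ∀ i, Set (Fin (r i))} {M M' : Matrix (BIdx K r S) (MIdx K r) k}
    {L L' : Submodule ↥(ModelAlgebra k K r S) ↥(ModelAlgebra k K r S)}
    (hL : IsNormalForm T M L) (hL' : IsNormalForm T M' L')
    {g : ∀ i, GL (Fin (aDim K r S i)) k} {h : ∀ i, GL (Fin (r i)) k}
    (hM : Dl k K r S g * M' = M * Dr k K r h)
    (hT : diagIdempotent k T * Dr k K r h = diagIdempotent k T)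
    {x : ↥(ModelAlgebra k K r S)} (hx : x ∈ L) :
    x * (diagUnit h : (↥(ModelAlgebra k K r S))ˣ) ∈ L' := by
  obtain ⟨hc, C, hC, hxC⟩ := (hL.mem_iff x).1 hx
  have hc' : const x * Dr k K r h = const x := by
    rw [← hc, Matrix.mul_assoc, hT]
  have hx' : coeff x = coeff x * diagIdempotent k T + C * M := by
    rw [← hxC, ← Matrix.mul_add, add_sub_cancel, Matrix.mul_one]
  have hM' : M' * (1 - diagIdempotent k T) = M' := by
    rw [Matrix.mul_sub, hL'.mul_eq_zero, sub_zero, Matrix.mul_one]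
  have hT' : diagIdempotent k T * (1 - diagIdempotent k T) = 0 := by
    rw [Matrix.mul_sub, diagIdempotent_mul_self, Matrix.mul_one, sub_self]
  refine (hL'.mem_iff _).2 ⟨by simp [diagUnit, hc', hc], C * Dl k K r S g,
    hC.blockDiag_mul (Dl_blockSupported g), ?_⟩
  have h1 : coeff x * Dr k K r h = coeff x * diagIdempotent k T + C * Dl k K r S g * M' := by
    rw [Matrix.mul_assoc C, hM, ← Matrix.mul_assoc, ← hxC]
    conv_lhs => rw [hx', Matrix.add_mul, Matrix.mul_assoc, hT, ← hxC]
  simp only [diagUnit, coeff_mul, const_mk, coeff_mk, Matrix.mul_zero, zero_add]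
  rw [h1, Matrix.add_mul, Matrix.mul_assoc, hT', Matrix.mul_zero, zero_add, Matrix.mul_assoc, hM']

theorem IsNormalForm.conj {T : ∀ i, Set (Fin (r i))}
    {M M' : {M : Matrix (BIdx K r S) (MIdx K r) k // M ∈ MSet k K r S}}
    {L L' : Submodule ↥(ModelAlgebra k K r S) ↥(ModelAlgebra k K r S)}
    (hL : IsNormalForm T M.1 L) (hL' : IsNormalForm T M'.1 L')
    (h : DoubleCosetRel k K r S M M') : ConjLeftIdeal ↥(ModelAlgebra k K r S) L L' := by
  obtain ⟨g, h, hM⟩ := h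
  obtain ⟨h', hM', hT⟩ := exists_mul_blockDiagonal'_GL_eq (Dl k K r S g * M.1) M'.1
    (fun i => diagonal ((T i).indicator 1)) h (fun i => diagonal_indicator_mul_self _)
    (by rw [Matrix.mul_assoc]; exact (congrArg _ hL.mul_eq_zero).trans (Matrix.mul_zero _))
    hL'.mul_eq_zero hM
  change M'.1 = Dl k K r S g * M.1 * Dr k K r h' at hM'
  change diagIdempotent k T * Dr k K r h' = diagIdempotent k T at hT
  refine conjLeftIdeal_iff.2 ⟨diagUnit h', fun x => ⟨fun hx => ?_, fun hx => ?_⟩⟩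
  · refine hL.mul_mem hL' (g := g⁻¹) ?_ hT hx
    rw [hM', Matrix.mul_assoc, ← Matrix.mul_assoc, Dl_inv_mul, Matrix.one_mul]
  · have := hL'.mul_mem hL (g := g) (h := h'⁻¹)
      (by rw [hM', Matrix.mul_assoc _ (Dr k K r h'), Dr_mul_inv, Matrix.mul_one])
      (by rw [← hT, Matrix.mul_assoc, Dr_mul_inv, Matrix.mul_one, hT]) hx
    have hunit : (diagUnit h'⁻¹ : (↥(ModelAlgebra k K r S))ˣ) = (diagUnit h')⁻¹ := Units.ext rfl
    rwa [hunit, Units.mul_inv_cancel_right] at this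

theorem exists_conj_isNormalForm (hr : ∀ i, 0 < r i)
    (L : Submodule ↥(ModelAlgebra k K r S) ↥(ModelAlgebra k K r S)) :
    ∃ (T : ∀ i, Set (Fin (r i))) (M : {M : Matrix (BIdx K r S) (MIdx K r) k // M ∈ MSet k K r S})
      (L' : Submodule ↥(ModelAlgebra k K r S) ↥(ModelAlgebra k K r S)),
      ConjLeftIdeal ↥(ModelAlgebra k K r S) L L' ∧ IsNormalForm T M.1 L' := by
  have : ∀ i, Nonempty (Fin (r i)) := fun i => ⟨⟨0, hr i⟩⟩
  obtain ⟨T, L', hL, hTL, hLT⟩ := exists_conj_diagIdempotent_mem hr L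
  set E := diagIdempotent k T with hE
  have hEE : E * E = E := diagIdempotent_mul_self T
  obtain ⟨M, hM, hLM⟩ := exists_forall_mem_iff_eq_blockDiag_mul (fun i j => (i, j) ∈ S)
    (aDim K r S) (fun i => (card_sigma_fst fun j => (i, j) ∈ S).le) (radicalSubmodule L' E)
    (by rintro _ ⟨-, x, -, -, rfl⟩; exact coeff_blockSupported x)
    (by
      rintro C hC _ ⟨hxE, x, hx, hx0, rfl⟩
      exact ⟨by rw [Matrix.mul_assoc, hxE, Matrix.mul_zero],
        mk C 0 hC BlockSupported.zero * x, L'.smul_mem _ hx, by simp [hx0], by simp [hx0]⟩)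
  refine ⟨T, ⟨M, hM⟩, L', hL, hM, ?_, fun x => ⟨fun hx => ⟨hLT x hx, ?_⟩, ?_⟩⟩
  · ext ⟨i, s⟩ q
    have h1 := ((hLM _).2 ⟨_, BlockSupported.single i (⟨0, hr i⟩ : Fin (r i)) s (1 : k), rfl⟩).1
    rw [Matrix.mul_assoc] at h1
    simpa using congrFun (congrFun h1 ⟨i, ⟨0, hr i⟩⟩) q
  · refine (hLM _).1 ⟨by rw [Matrix.mul_assoc, Matrix.sub_mul, hEE, Matrix.one_mul, sub_self,
      Matrix.mul_zero], _, L'.sub_mem hx (L'.smul_mem x hTL), ?_, ?_⟩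
    · simp [← hE, hLT x hx]
    · simp [← hE, Matrix.mul_sub]
  · rintro ⟨hxE, C, hC, hxC⟩
    rw [← hE] at hxE hxC
    obtain ⟨-, z, hz, hz0, hzC⟩ := (hLM _).2 ⟨C, hC, rfl⟩
    have : x = x * mk E 0 (diagIdempotent_blockSupported T) BlockSupported.zero + z :=
      ext (by simp [hxE, hz0]) (by simp [hzC, ← hxC, Matrix.mul_sub])
    rw [this]
    exact L'.add_mem (L'.smul_mem x hTL) hz

end ModelAlgebra

set_option maxHeartbeats 1000000 in
set_option synthInstance.maxHeartbeats 400000 in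
/-- let `k` be algebraically closed and let `A` be the matrix-model algebra,
with distributive lattice of two-sided ideals.  Then `A` has finitely many conjugacy classes
of left ideals iff the number of `G_l × G_r` orbits on `ℳ_A` is finite. -/
theorem finConjClasses_iff_finitely_many_orbits
    (k : Type) [Field k] [IsAlgClosed k]
    (K : ℕ) (r : Fin K → ℕ) (hr : ∀ i, 0 < r i)
    (S : Set (Fin K × Fin K)) [DecidablePred (· ∈ S)]
    (hdistrib : ∀ I J L : TwoSidedIdeal ↥(ModelAlgebra k K r S),
      I ⊓ (J ⊔ L) = (I ⊓ J) ⊔ (I ⊓ L)) :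
    HasFinitelyManyConjClassesOfLeftIdeals ↥(ModelAlgebra k K r S) ↔
      Finite (Quot (DoubleCosetRel k K r S)) := by
  constructor
  · intro h
    change Finite (Quot _) at h
    refine Finite.of_injective (fun q : Quot (DoubleCosetRel k K r S) =>
      (Quot.mk (ConjLeftIdeal ↥(ModelAlgebra k K r S)) (ModelAlgebra.rowIdeal q.out.1))) ?_
    intro q q' hqq
    rw [← q.out_eq, ← q'.out_eq]
    exact Quot.sound <| ModelAlgebra.doubleCosetRel_of_conj_rowIdeal hr _ _ <|
      (conjLeftIdeal_equivalence _).quot_mk_eq_iff _ _ |>.1 hqq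
  · intro h
    choose T M N hN hNM using
      fun L => ModelAlgebra.exists_conj_isNormalForm (k := k) (K := K) (r := r) (S := S) hr L
    refine Finite.of_injective (fun q : Quot (ConjLeftIdeal ↥(ModelAlgebra k K r S)) =>
      ((T q.out, Quot.mk (DoubleCosetRel k K r S) (M q.out)) :
        (∀ i, Set (Fin (r i))) × Quot (DoubleCosetRel k K r S))) ?_
    intro q q' hqq
    obtain ⟨hT, hM⟩ := Prod.ext_iff.1 hqq
    rw [← q.out_eq, ← q'.out_eq]
    have hconj := (hNM q.out).conj (M := M q.out) (M' := M q'.out)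
      ((show T q.out = T q'.out from hT) ▸ hNM q'.out)
      (doubleCosetRel_equivalence.quot_mk_eq_iff _ _ |>.1 hM)
    exact Quot.sound <| (conjLeftIdeal_equivalence _).trans (hN _) <|
      (conjLeftIdeal_equivalence _).trans hconj ((conjLeftIdeal_equivalence _).symm (hN _))
end

section
/- Let k be an algebraically closed field, Q a finite quiver with vertex set {1, …, m}, and d ∈ ℕ^m a dimension vector such that the number of G(d)-orbits on 𝔸_Q(d) is finite. Let Q' be a subquiver of Q, that is, a subset V' of the vertices of Q together with a subset of the arrows of Q having both endpoints in V', and let e be the restriction of d to V'. Then no positive vector e' with e' ≤ e belongs to the radical of the Tits form q_{Q'}, where the radical of q_{Q'} is the set of integer vectors x indexed by V' such that q_{Q'}(x + y) = q_{Q'}(x) + q_{Q'}(y) for every integer vector y indexed by V'. -/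
open scoped Matrix

/-- The representation space `𝔸_Q(d)` of a quiver with vertex set `Fin m`, arrow set `E` and
source/target maps `src, tgt`, for the dimension vector `d`. -/
def RepSpace (k : Type) [Field k] {m : ℕ} {E : Type} (src tgt : E → Fin m)
    (d : Fin m → ℕ) : Type :=
  ∀ a : E, Matrix (Fin (d (tgt a))) (Fin (d (src a))) k

/-- Two points of `𝔸_Q(d)` lie in the same `G(d)`-orbit, where
`G(d) = ∏ᵢ GL_{dᵢ}(k)` acts by `(g · x)_α = g_{tgt α} x_α g_{src α}⁻¹`. -/
def RepOrbitRel (k : Type) [Field k] {m : ℕ} {E : Type} (src tgt : E → Fin m)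
    (d : Fin m → ℕ) (x y : RepSpace k src tgt d) : Prop :=
  ∃ g : ∀ i : Fin m, Matrix.GeneralLinearGroup (Fin (d i)) k,
    ∀ a : E, y a = ((g (tgt a) : Matrix (Fin (d (tgt a))) (Fin (d (tgt a))) k) * x a) *
      (((g (src a))⁻¹ : Matrix.GeneralLinearGroup (Fin (d (src a))) k) :
        Matrix (Fin (d (src a))) (Fin (d (src a))) k)

/-- The Tits form `q_{Q'}` of the subquiver `Q'` of `Q` with vertex set `V'` and arrow set `E'`
(all arrows of `E'` having both endpoints in `V'`), evaluated on integer vectors indexed by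
the vertices of `Q'`. -/
def TitsFormSub {m : ℕ} {E : Type} [Fintype E] (src tgt : E → Fin m)
    (V' : Finset (Fin m)) (E' : Finset E)
    (h : ∀ a ∈ E', src a ∈ V' ∧ tgt a ∈ V') (x : {i // i ∈ V'} → ℤ) : ℤ :=
  ∑ i : {i // i ∈ V'}, x i ^ 2 -
    ∑ a : {a // a ∈ E'}, x ⟨src a.1, (h a.1 a.2).1⟩ * x ⟨tgt a.1, (h a.1 a.2).2⟩

theorem Matrix.exists_isUnit_toBlocks₁₁_add {K p q : Type*} [Field K] [Infinite K]
    [Fintype p] [Fintype q] [DecidableEq p] [DecidableEq q]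
    (M : Matrix (p ⊕ q) (p ⊕ q) K) (hM : IsUnit M) :
    ∃ T : Matrix q q K, IsUnit (M.toBlocks₁₁ + M.toBlocks₁₂ * T * M.toBlocks₂₁) := by
  obtain ⟨A, B, C, D, rfl⟩ : ∃ A B C D, M = Matrix.fromBlocks A B C D :=
    ⟨_, _, _, _, (Matrix.fromBlocks_toBlocks M).symm⟩
  simp only [Matrix.toBlocks_fromBlocks₁₁, Matrix.toBlocks_fromBlocks₁₂,
    Matrix.toBlocks_fromBlocks₂₁]
  let f : Polynomial K := ((Matrix.fromBlocks A B C D).map Polynomial.C +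
    (Matrix.fromBlocks 0 0 0 (Matrix.scalar q Polynomial.X))).det
  have hf : ∀ t, f.eval t = (Matrix.fromBlocks A B C (D + Matrix.scalar q t)).det := by
    intro t
    rw [← Polynomial.coe_evalRingHom, RingHom.map_det]
    congr 1
    ext (i | i) (j | j)
    · simp
    · simp
    · simp
    · by_cases hij : i = j <;> simp [hij]
  have hg : ∀ t, (-D).charpoly.eval t = (D + Matrix.scalar q t).det := by
    intro t
    rw [Matrix.eval_charpoly, sub_neg_eq_add, add_comm]
  have hfg : f * (-D).charpoly ≠ 0 := by
    refine mul_ne_zero (fun h0 ↦ ?_) (Matrix.charpoly_monic _).ne_zero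
    have := hf 0
    rw [h0] at this
    simp only [Polynomial.eval_zero, map_zero, add_zero] at this
    exact ((Matrix.isUnit_iff_isUnit_det _).1 hM).ne_zero this.symm
  obtain ⟨t, ht⟩ : ∃ t, (f * (-D).charpoly).eval t ≠ 0 := by
    by_contra! hc
    exact hfg (Polynomial.funext fun t ↦ by simpa using hc t)
  rw [Polynomial.eval_mul, hf, hg] at ht
  have hD : IsUnit (D + Matrix.scalar q t) :=
    (Matrix.isUnit_iff_isUnit_det _).2 (right_ne_zero_of_mul ht).isUnit
  let := hD.invertible
  have h1 := left_ne_zero_of_mul ht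
  rw [Matrix.det_fromBlocks₂₂] at h1
  refine ⟨-⅟(D + Matrix.scalar q t), ?_⟩
  rw [Matrix.isUnit_iff_isUnit_det, Matrix.mul_neg, Matrix.neg_mul, ← sub_eq_add_neg]
  exact (right_ne_zero_of_mul h1).isUnit

theorem repOrbitRel_iff {k : Type} [Field k] {m : ℕ} {E : Type} {src tgt : E → Fin m}
    {d : Fin m → ℕ} {x y : RepSpace k src tgt d} :
    RepOrbitRel k src tgt d x y ↔ ∃ g : ∀ i, Matrix (Fin (d i)) (Fin (d i)) k,
      (∀ i, IsUnit (g i)) ∧ ∀ a, y a * g (src a) = g (tgt a) * x a := by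
  constructor
  · rintro ⟨g, hg⟩
    refine ⟨fun i ↦ g i, fun i ↦ (g i).isUnit, fun a ↦ ?_⟩
    rw [hg, Matrix.mul_assoc, Units.inv_mul, Matrix.mul_one]
  · rintro ⟨g, hu, hg⟩
    refine ⟨fun i ↦ (hu i).unit, fun a ↦ ?_⟩
    have h1 := congrArg (· * (((hu (src a)).unit⁻¹ : Matrix.GeneralLinearGroup _ k) :
      Matrix (Fin (d (src a))) (Fin (d (src a))) k)) (hg a)
    simpa only [Matrix.mul_assoc, IsUnit.mul_val_inv, Matrix.mul_one, IsUnit.unit_spec] using h1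

theorem repOrbitRel_equivalence (k : Type) [Field k] {m : ℕ} {E : Type} (src tgt : E → Fin m)
    (d : Fin m → ℕ) : Equivalence (RepOrbitRel k src tgt d) where
  refl x := ⟨1, fun a ↦ by simp⟩
  symm := by
    rintro x y ⟨g, hg⟩
    refine ⟨g⁻¹, fun a ↦ ?_⟩
    simp only [Pi.inv_apply, inv_inv]
    rw [hg, Matrix.mul_assoc, Matrix.mul_assoc, Units.inv_mul, Matrix.mul_one,
      ← Matrix.mul_assoc, Units.inv_mul, Matrix.one_mul]
  trans := by
    rintro x y z ⟨g, hg⟩ ⟨g', hg'⟩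
    refine ⟨g' * g, fun a ↦ ?_⟩
    rw [hg', hg]
    simp only [Pi.mul_apply, mul_inv_rev, Units.val_mul, Matrix.mul_assoc]

section Extension

variable {k : Type} [Field k] {m : ℕ} {E : Type} {src tgt : E → Fin m} {d n : Fin m → ℕ}

open Classical in
/-- Extension by zero of a representation of the subquiver with arrows `E'` and dimension
vector `n` to a representation of dimension vector `d`, along decompositions `k^d = k^n ⊕ k^c`. -/
noncomputable def RepSpace.extendZero (E' : Finset E) {c : Fin m → ℕ}
    (e : ∀ i, Fin (d i) ≃ Fin (n i) ⊕ Fin (c i))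
    (x : RepSpace k (fun a : E' ↦ src a) (fun a : E' ↦ tgt a) n) : RepSpace k src tgt d :=
  fun a ↦ if ha : a ∈ E' then
    (Matrix.fromBlocks (x ⟨a, ha⟩) 0 0 0).submatrix (e (tgt a)) (e (src a)) else 0

/-- Zero summands can be cancelled from an isomorphism of representations. -/
theorem RepOrbitRel.of_extendZero [Infinite k] {E' : Finset E} {c : Fin m → ℕ}
    {e : ∀ i, Fin (d i) ≃ Fin (n i) ⊕ Fin (c i)}
    {x y : RepSpace k (fun a : E' ↦ src a) (fun a : E' ↦ tgt a) n}
    (hxy : RepOrbitRel k src tgt d (RepSpace.extendZero E' e x) (RepSpace.extendZero E' e y)) :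
    RepOrbitRel k (fun a : E' ↦ src a) (fun a : E' ↦ tgt a) n x y := by
  rw [repOrbitRel_iff] at hxy ⊢
  obtain ⟨g, hu, hg⟩ := hxy
  let M : ∀ i, Matrix (Fin (n i) ⊕ Fin (c i)) (Fin (n i) ⊕ Fin (c i)) k :=
    fun i ↦ (g i).submatrix (e i).symm (e i).symm
  have hM : ∀ i, IsUnit (M i) := fun i ↦ by
    rw [Matrix.isUnit_submatrix_equiv]
    exact hu i
  choose T hT using fun i ↦ Matrix.exists_isUnit_toBlocks₁₁_add (M i) (hM i)
  refine ⟨_, hT, fun a ↦ ?_⟩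
  let X : Matrix (Fin (n (tgt a))) (Fin (n (src a))) k := x a
  let Y : Matrix (Fin (n (tgt a))) (Fin (n (src a))) k := y a
  change Y * _ = _ * X
  let Z (A : Matrix (Fin (n (tgt a))) (Fin (n (src a))) k) :
      Matrix (Fin (n (tgt a)) ⊕ Fin (c (tgt a))) (Fin (n (src a)) ⊕ Fin (c (src a))) k :=
    Matrix.fromBlocks A 0 0 0
  have h1 : Z Y * M (src a) = M (tgt a) * Z X := by
    have h2 := congrArg (Matrix.submatrix · (e (tgt a)).symm (e (src a)).symm) (hg a)
    simp only [RepSpace.extendZero, a.2, dite_true] at h2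
    rw [← Matrix.submatrix_mul_equiv _ _ _ (e (src a)).symm,
      ← Matrix.submatrix_mul_equiv _ _ _ (e (tgt a)).symm] at h2
    simpa [Matrix.submatrix_submatrix] using h2
  simp only [Z] at h1
  rw [← Matrix.fromBlocks_toBlocks (M (src a)), ← Matrix.fromBlocks_toBlocks (M (tgt a)),
    Matrix.fromBlocks_multiply, Matrix.fromBlocks_multiply, Matrix.fromBlocks_inj] at h1
  simp only [Matrix.zero_mul, Matrix.mul_zero, add_zero] at h1
  obtain ⟨h11, h12, h21, -⟩ := h1
  rw [Matrix.mul_add, Matrix.add_mul, h11, ← Matrix.mul_assoc, ← Matrix.mul_assoc, h12,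
    Matrix.mul_assoc _ _ X, ← h21]
  simp

end Extension

section Generic

variable {k : Type} [Field k] {m : ℕ} {F : Type} [Fintype F] {src tgt : F → Fin m}
  {n : Fin m → ℕ}

open Classical in
/-- The generic element of `∏ᵢ M_{nᵢ}` whose entry at the position `c` is normalised to `1`. -/
noncomputable def genericNormalizedMatrix (k : Type) [Field k]
    (c : Σ i, Fin (n i) × Fin (n i)) (i : Fin m) :
    Matrix (Fin (n i)) (Fin (n i)) (MvPolynomial {p // p ≠ c} k) :=
  fun p q ↦ if h : (⟨i, p, q⟩ : Σ i, Fin (n i) × Fin (n i)) = c then 1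
    else MvPolynomial.X ⟨⟨i, p, q⟩, h⟩

theorem genericNormalizedMatrix_map_aeval {c : Σ i, Fin (n i) × Fin (n i)}
    (g : ∀ i, Matrix (Fin (n i)) (Fin (n i)) k) (hc : g c.1 c.2.1 c.2.2 = 1) (i : Fin m) :
    (genericNormalizedMatrix k c i).map
      (MvPolynomial.aeval fun p : {p // p ≠ c} ↦ g p.1.1 p.1.2.1 p.1.2.2) = g i := by
  ext p q
  by_cases h : (⟨i, p, q⟩ : Σ i, Fin (n i) × Fin (n i)) = c
  · subst h
    simpa [genericNormalizedMatrix] using hc.symm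
  · simp [genericNormalizedMatrix, h]

/-- The elements of the orbit of `x` obtained from a `g` whose entry at `c` equals `1` satisfy a
nontrivial polynomial relation, since there are fewer parameters than coordinates. -/
theorem exists_mvPolynomial_vanishing (x : RepSpace k src tgt n)
    (c : Σ i, Fin (n i) × Fin (n i))
    (hcard : ∑ i, n i * n i ≤ ∑ a, n (tgt a) * n (src a)) :
    ∃ P : MvPolynomial (Σ a, Fin (n (tgt a)) × Fin (n (src a))) k, P ≠ 0 ∧
      ∀ (g : ∀ i, Matrix (Fin (n i)) (Fin (n i)) k) (y : RepSpace k src tgt n),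
        (∀ i, IsUnit (g i)) → (∀ a, y a * g (src a) = g (tgt a) * x a) →
        g c.1 c.2.1 c.2.2 = 1 → MvPolynomial.eval (fun p ↦ y p.1 p.2.1 p.2.2) P = 0 := by
  classical
  let S := MvPolynomial {p // p ≠ c} k
  let Δ : S := ∏ i, (genericNormalizedMatrix k c i).det
  have hev : ∀ g : ∀ i, Matrix (Fin (n i)) (Fin (n i)) k, g c.1 c.2.1 c.2.2 = 1 →
      MvPolynomial.aeval (fun p : {p // p ≠ c} ↦ g p.1.1 p.1.2.1 p.1.2.2) Δ =
        ∏ i, (g i).det := by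
    intro g hc
    rw [map_prod]
    refine Finset.prod_congr rfl fun i _ ↦ ?_
    rw [AlgHom.map_det]
    exact congrArg _ (genericNormalizedMatrix_map_aeval g hc i)
  have hdet : ∀ g : ∀ i, Matrix (Fin (n i)) (Fin (n i)) k, (∀ i, IsUnit (g i)) →
      IsUnit (∏ i, (g i).det) := fun g hg ↦
    IsUnit.prod_univ_iff.2 fun i ↦ (Matrix.isUnit_iff_isUnit_det _).1 (hg i)
  by_cases hΔ : Δ = 0
  · refine ⟨1, one_ne_zero, fun g y hg _ hc ↦ absurd (hev g hc) ?_⟩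
    rw [hΔ, map_zero]
    exact (hdet g hg).ne_zero.symm
  let R := Localization.Away Δ
  have hle : Submonoid.powers Δ ≤ nonZeroDivisors S :=
    powers_le_nonZeroDivisors_of_noZeroDivisors hΔ
  have : IsDomain R := IsLocalization.isDomain_localization hle
  have : FaithfulSMul S R :=
    (faithfulSMul_iff_algebraMap_injective _ _).2 (IsLocalization.injective R hle)
  have : Algebra.IsAlgebraic S R := IsLocalization.isAlgebraic R (Submonoid.powers Δ)
  have htr : Algebra.trdeg k R = Fintype.card {p // p ≠ c} := by
    rw [← trdeg_add_eq k S (A := R), trdeg_eq_zero (R := S), add_zero,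
      MvPolynomial.trdeg_of_isDomain]
    simp
  let G : ∀ i, Matrix (Fin (n i)) (Fin (n i)) R := fun i ↦
    (genericNormalizedMatrix k c i).map (algebraMap S R)
  have hG : ∀ i, IsUnit (G i) := by
    have h1 : IsUnit (algebraMap S R Δ) := IsLocalization.Away.algebraMap_isUnit Δ
    rw [map_prod, IsUnit.prod_univ_iff] at h1
    intro i
    rw [Matrix.isUnit_iff_isUnit_det]
    have := h1 i
    rwa [RingHom.map_det] at this
  let Y : ∀ a, Matrix (Fin (n (tgt a))) (Fin (n (src a))) R := fun a ↦
    G (tgt a) * (x a).map (algebraMap k R) * (G (src a))⁻¹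
  have hY : ∀ a, Y a * G (src a) = G (tgt a) * (x a).map (algebraMap k R) := fun a ↦ by
    rw [Matrix.mul_assoc, Matrix.nonsing_inv_mul _ ((Matrix.isUnit_iff_isUnit_det _).1 (hG _)),
      Matrix.mul_one]
  have hdep : ¬ AlgebraicIndependent k
      (fun p : Σ a, Fin (n (tgt a)) × Fin (n (src a)) ↦ Y p.1 p.2.1 p.2.2) := by
    intro hind
    have h1 := hind.cardinalMk_le_trdeg
    rw [htr, Cardinal.mk_fintype, Nat.cast_le] at h1
    have h2 : Fintype.card {p // p ≠ c} < Fintype.card (Σ i, Fin (n i) × Fin (n i)) :=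
      Fintype.card_subtype_lt (x := c) (by simp)
    simp only [Fintype.card_sigma, Fintype.card_prod, Fintype.card_fin] at h1 h2
    omega
  rw [algebraicIndependent_iff] at hdep
  push Not at hdep
  obtain ⟨P, hP, hP0⟩ := hdep
  refine ⟨P, hP0, fun g y hg hy hc ↦ ?_⟩
  let φ : R →ₐ[k] k := IsLocalization.Away.liftAlgHom Δ (f := MvPolynomial.aeval
    fun p : {p // p ≠ c} ↦ g p.1.1 p.1.2.1 p.1.2.2) (by rw [hev g hc]; exact hdet g hg)
  have hφG : ∀ i, (G i).map φ = g i := by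
    intro i
    rw [← genericNormalizedMatrix_map_aeval g hc i, Matrix.map_map]
    ext p q
    simp only [Matrix.map_apply, Function.comp_apply, φ, IsLocalization.Away.coe_liftAlgHom]
    exact IsLocalization.Away.lift_eq _ _ _
  have hφY : ∀ a, (Y a).map φ = y a := by
    intro a
    have h1 := congrArg (fun A ↦ Matrix.map A φ) (hY a)
    simp only [Matrix.map_mul, hφG, Matrix.map_map] at h1
    have h2 : (x a).map (φ ∘ algebraMap k R) = x a := by
      ext p q
      simp
    rw [h2, ← hy] at h1
    have h3 := congrArg (· * (g (src a))⁻¹) h1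
    simpa only [Matrix.mul_assoc,
      Matrix.mul_nonsing_inv _ ((Matrix.isUnit_iff_isUnit_det _).1 (hg (src a))),
      Matrix.mul_one] using h3
  have h4 := congrArg φ hP
  rw [map_zero, ← AlgHom.comp_apply, MvPolynomial.comp_aeval] at h4
  have h5 : (fun p : Σ a, Fin (n (tgt a)) × Fin (n (src a)) ↦ φ (Y p.1 p.2.1 p.2.2)) =
      fun p ↦ y p.1 p.2.1 p.2.2 := funext fun p ↦ by
    rw [← hφY]
    rfl
  rwa [h5, MvPolynomial.aeval_eq_eval] at h4

/-- Over an infinite field, finitely many orbits do not cover `𝔸(n)` if the Tits form is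
nonpositive at the nonzero dimension vector `n`. -/
theorem exists_not_repOrbitRel [Infinite k] (hn : n ≠ 0)
    (hcard : ∑ i, n i * n i ≤ ∑ a, n (tgt a) * n (src a))
    {ι : Type*} [Finite ι] (x : ι → RepSpace k src tgt n) :
    ∃ y, ∀ j, ¬ RepOrbitRel k src tgt n (x j) y := by
  have := Fintype.ofFinite ι
  choose P hP0 hP using fun (j : ι) (c : Σ i, Fin (n i) × Fin (n i)) ↦
    exists_mvPolynomial_vanishing (x j) c hcard
  obtain ⟨v, hv⟩ : ∃ v, MvPolynomial.eval v (∏ j, ∏ c, P j c) ≠ 0 := by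
    by_contra! hc
    have h0 : ∏ j, ∏ c, P j c = 0 := MvPolynomial.funext fun v ↦ by rw [hc, map_zero]
    exact Finset.prod_ne_zero_iff.2 (fun j _ ↦ Finset.prod_ne_zero_iff.2 fun c _ ↦ hP0 j c) h0
  simp only [map_prod, Finset.prod_ne_zero_iff] at hv
  let y : RepSpace k src tgt n := fun a ↦ Matrix.of fun p q ↦ v ⟨a, p, q⟩
  refine ⟨y, fun j hj ↦ ?_⟩
  obtain ⟨g, hu, hg⟩ := repOrbitRel_iff.1 hj
  obtain ⟨i, hi⟩ := Function.ne_iff.1 hn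
  have : NeZero (n i) := ⟨hi⟩
  obtain ⟨p, q, hpq⟩ : ∃ p q, g i p q ≠ 0 := by
    by_contra! hc
    exact (hu i).ne_zero (Matrix.ext hc)
  refine hv j (Finset.mem_univ _) ⟨i, p, q⟩ (Finset.mem_univ _)
    (hP j ⟨i, p, q⟩ (fun l ↦ (g i p q)⁻¹ • g l) y (fun l ↦ ?_) (fun a ↦ ?_) ?_)
  · exact (hu l).smul (Units.mk0 _ (inv_ne_zero hpq))
  · rw [Matrix.mul_smul, Matrix.smul_mul, hg]
  · simp [hpq]

end Generic

/-- let `k` be algebraically closed and suppose the number of `G(d)`-orbits on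
`𝔸_Q(d)` is finite.  If `Q'` is a subquiver of `Q` with vertices `V'` and arrows `E'`, and `e`
is the restriction of `d` to `V'`, then no positive vector `e' ≤ e` lies in the radical of the
Tits form `q_{Q'}`, i.e. satisfies `q_{Q'}(e' + y) = q_{Q'}(e') + q_{Q'}(y)` for all `y`. -/
theorem no_positive_radical_vector_of_finite_orbits (k : Type) [Field k] [IsAlgClosed k]
    {m : ℕ} {E : Type} [Fintype E] (src tgt : E → Fin m) (d : Fin m → ℕ)
    (hfin : Finite (Quot (RepOrbitRel k src tgt d)))
    (V' : Finset (Fin m)) (E' : Finset E)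
    (h : ∀ a ∈ E', src a ∈ V' ∧ tgt a ∈ V')
    (e' : {i // i ∈ V'} → ℤ) (hne : e' ≠ 0) (hnonneg : ∀ i, 0 ≤ e' i)
    (hle : ∀ i, e' i ≤ (d i.1 : ℤ)) :
    ¬ ∀ y : {i // i ∈ V'} → ℤ,
        TitsFormSub src tgt V' E' h (e' + y) =
          TitsFormSub src tgt V' E' h e' + TitsFormSub src tgt V' E' h y := by
  intro hrad
  classical
  let n : Fin m → ℕ := fun i ↦ if hi : i ∈ V' then (e' ⟨i, hi⟩).toNat else 0
  have hnV : ∀ i : {i // i ∈ V'}, (n i.1 : ℤ) = e' i := fun i ↦ by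
    simp [n, i.2, hnonneg i]
  have hnd : ∀ i, n i ≤ d i := fun i ↦ by
    by_cases hi : i ∈ V'
    · have h1 := hnV ⟨i, hi⟩
      have h2 := hle ⟨i, hi⟩
      simp only at h1 h2
      omega
    · simp [n, hi]
  have hn : n ≠ 0 := by
    rintro h0
    refine hne (funext fun i ↦ ?_)
    rw [← hnV, h0]
    rfl
  have hq : TitsFormSub src tgt V' E' h e' = 0 := by
    have h1 : TitsFormSub src tgt V' E' h (e' + e') = 4 * TitsFormSub src tgt V' E' h e' := by
      simp only [TitsFormSub, Pi.add_apply, mul_sub, Finset.mul_sum]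
      congr 1 <;> exact Finset.sum_congr rfl fun _ _ ↦ by ring
    linarith [hrad e']
  have hcard : ∑ i, n i * n i ≤ ∑ a : E', n (tgt a) * n (src a) := by
    have h1 : ∑ i : {i // i ∈ V'}, n i * n i = ∑ i, n i * n i := by
      rw [Finset.sum_coe_sort V' fun i ↦ n i * n i]
      exact Finset.sum_subset (Finset.subset_univ _) fun i _ hi ↦ by simp [n, hi]
    rw [← h1]
    zify
    simp only [TitsFormSub, ← hnV] at hq
    rw [sub_eq_zero] at hq
    refine le_of_eq ((Finset.sum_congr rfl fun _ _ ↦ (sq _).symm).trans (hq.trans ?_))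
    exact Finset.sum_congr rfl fun _ _ ↦ mul_comm _ _
  have : Infinite k := IsAlgClosed.instInfinite
  let e : ∀ i, Fin (d i) ≃ Fin (n i) ⊕ Fin (d i - n i) := fun i ↦
    (finCongr (Nat.add_sub_cancel' (hnd i)).symm).trans finSumFinEquiv.symm
  let f : RepSpace k (fun a : E' ↦ src a) (fun a : E' ↦ tgt a) n →
      Quot (RepOrbitRel k src tgt d) := fun x ↦ Quot.mk _ (RepSpace.extendZero E' e x)
  obtain ⟨y, hy⟩ := exists_not_repOrbitRel hn hcard
    (fun j : Set.range f ↦ (j.2.choose))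
  refine hy ⟨f y, y, rfl⟩ (RepOrbitRel.of_extendZero (e := e) ?_)
  have h1 : f _ = f y := (⟨y, rfl⟩ : f y ∈ Set.range f).choose_spec
  exact (repOrbitRel_equivalence k src tgt d).eqvGen_iff.1 (Quot.eqvGen_exact h1)
end
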